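/- arXiv:1904.01332 — 7 statements merged into one kernel-verified Lean document; each statement's English description precedes it below -/
import Mathlib

section
/- For any field F and any partition λ = (λ₁, λ₂) of r, the family {b(i) : 0 ≤ i ≤ λ₂} is an F-vector-space basis of S_F(λ) = End_{FS_r}(M^λ); in particular dim_F S_F(λ) = λ₂ + 1. -/
open Finset

noncomputable section

/-- Index set for the basis of the Young permutation module `M^λ`:
subsets of `{1,…,r}` of size `λ₂`. -/
abbrev Idx (r k : ℕ) : Type := {S : Finset (Fin r) // S.card = k}

/-- The Young permutation module `M^λ` for `λ = (r - k, k)`,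
with basis `{v_S : S ⊆ {1,…,r}, |S| = k}`. -/
def YM (F : Type*) [Field F] (r k : ℕ) : Type _ := Idx r k →₀ F

noncomputable instance (F : Type*) [Field F] (r k : ℕ) : AddCommGroup (YM F r k) :=
  inferInstanceAs (AddCommGroup (Idx r k →₀ F))

noncomputable instance (F : Type*) [Field F] (r k : ℕ) : Module F (YM F r k) :=
  inferInstanceAs (Module F (Idx r k →₀ F))

/-- `v_t` if `t` has the right cardinality, and `0` otherwise. -/
noncomputable def vv (F : Type*) [Field F] (r k : ℕ) (t : Finset (Fin r)) : YM F r k :=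
  if h : t.card = k then Finsupp.single ⟨t, h⟩ 1 else 0

/-- The endomorphism of `M^λ` given on basis vectors by
`v_S ↦ Σ_{W ⊆ Sᶜ, |W| = a} Σ_{T ⊆ S∪W, |T| = a} v_{(S∪W)∖T}` (no truncation). -/
noncomputable def bRaw (F : Type*) [Field F] (r k : ℕ) (a : ℕ) : Module.End F (YM F r k) :=
  Finsupp.lift (YM F r k) F (Idx r k) (fun S =>
    ∑ W ∈ Finset.powersetCard a (S.1ᶜ),
      ∑ T ∈ Finset.powersetCard a (S.1 ∪ W),
        vv F r k ((S.1 ∪ W) \ T))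

/-- The element `b(a)` of `S_F(λ)`, with the convention `b(a) = 0` for `a > λ₂`. -/
noncomputable def bOp (F : Type*) [Field F] (r k : ℕ) (a : ℕ) : Module.End F (YM F r k) :=
  if a ≤ k then bRaw F r k a else 0

/-- The action of a permutation `σ ∈ S_r` on `M^λ`: `σ · v_S = v_{σ(S)}`. -/
noncomputable def permEnd (F : Type*) [Field F] (r k : ℕ) (σ : Equiv.Perm (Fin r)) :
    Module.End F (YM F r k) :=
  Finsupp.lmapDomain F F (fun S : Idx r k =>
    (⟨S.1.image σ, by rw [Finset.card_image_of_injective _ σ.injective]; exact S.2⟩ : Idx r k))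

/-- `S_F(λ) = End_{F S_r}(M^λ)`: the subalgebra of `F`-linear endomorphisms of `M^λ`
commuting with the `S_r`-action. -/
noncomputable def SF (F : Type*) [Field F] (r k : ℕ) :
    Subalgebra F (Module.End F (YM F r k)) :=
  Subalgebra.centralizer F (Set.range (permEnd F r k))

/-- `u`-th digit of `n` in base `p`. -/
def digit (p n u : ℕ) : ℕ := n / p ^ u % p

/-- `carry p m g u` is the carry *entering* column `u` in the `p`-ary addition of `m` and `g`;
so `carry p m g 0 = 0 (= x_{-1})` and `carry p m g (u+1) = x_u`, the carry leaving column `u`. -/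
def carry (p m g u : ℕ) : ℕ := (m % p ^ u + g % p ^ u) / p ^ u

/-- `ψ_{m,u} = Σ_{k=1}^{3^u − 1} C(m_{<u}, 3^u − k)·b(k)`. -/
noncomputable def psi (F : Type*) [Field F] (r k m u : ℕ) : Module.End F (YM F r k) :=
  ∑ j ∈ Finset.Icc 1 (3 ^ u - 1),
    ((Nat.choose (m % 3 ^ u) (3 ^ u - j) : ℕ) : F) • bOp F r k j

/-- Factor `u` of `e_{m,g}`, determined by the `u`-th ternary digits of `m+2g` and `g`. -/
noncomputable def factorEl (F : Type*) [Field F] (r k m g u : ℕ) : Module.End F (YM F r k) :=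
  if digit 3 (m + 2 * g) u = 0 ∧ digit 3 g u = 0 then
    1 + bOp F r k (3 ^ u) - bOp F r k (2 * 3 ^ u)
  else if digit 3 (m + 2 * g) u = 1 ∧ digit 3 g u = 0 then
    1 - bOp F r k (2 * 3 ^ u)
  else if digit 3 (m + 2 * g) u = 2 ∧ digit 3 g u = 0 then
    1 - bOp F r k (3 ^ u) + bOp F r k (2 * 3 ^ u)
  else if digit 3 (m + 2 * g) u = 1 ∧ digit 3 g u = 1 then
    bOp F r k (3 ^ u) - bOp F r k (2 * 3 ^ u)
  else if digit 3 (m + 2 * g) u = 2 ∧ digit 3 g u = 1 then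
    bOp F r k (2 * 3 ^ u) - bOp F r k (3 ^ u)
  else if digit 3 (m + 2 * g) u = 2 ∧ digit 3 g u = 2 then
    bOp F r k (2 * 3 ^ u)
  else 0

/-- The partial product `(e_{m,g})_{<t} = Π_{u=0}^{t-1} f_u` (so `(e_{m,g})_{≤t}` is
`emgLt _ _ _ _ _ (t+1)`). -/
noncomputable def emgLt (F : Type*) [Field F] (r k m g t : ℕ) : Module.End F (YM F r k) :=
  ((List.range t).map (factorEl F r k m g)).prod

/-- `e_{m,g} = Π_{u=0}^{N} f_u`, for `N = max(λ₂, m+2g) + 1` (which satisfies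
`3^N > max(λ₂, m+2g)`, making all later factors equal to `1`). -/
noncomputable def emg (F : Type*) [Field F] (r k m g : ℕ) : Module.End F (YM F r k) :=
  emgLt F r k m g (max k (m + 2 * g) + 2)

/-- The injective linear map `j : M^λ → M^{λ+(1²)}`,
`v_S ↦ v_{{2}∪s(S)} − v_{{1}∪s(S)}` where `s(S) = {i+2 : i ∈ S}`. -/
noncomputable def jmap (F : Type*) [Field F] (r k : ℕ) : YM F r k →ₗ[F] YM F (r + 2) (k + 1) :=
  Finsupp.lift (YM F (r + 2) (k + 1)) F (Idx r k) (fun S =>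
    vv F (r + 2) (k + 1) (insert 1 (S.1.image (fun i : Fin r => i.succ.succ)))
    - vv F (r + 2) (k + 1) (insert 0 (S.1.image (fun i : Fin r => i.succ.succ))))

end

namespace Aux

variable {F : Type*} [Field F] {r k : ℕ}

noncomputable def bs (F : Type*) [Field F] {r k : ℕ} (S : Idx r k) : YM F r k :=
  (Finsupp.single S 1 : Idx r k →₀ F)

noncomputable def ev (F : Type*) [Field F] {r k : ℕ} (S : Idx r k) : YM F r k →ₗ[F] F :=
  (Finsupp.lapply S : (Idx r k →₀ F) →ₗ[F] F)

def act (σ : Equiv.Perm (Fin r)) (S : Idx r k) : Idx r k :=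
  ⟨S.1.image σ, by rw [Finset.card_image_of_injective _ σ.injective]; exact S.2⟩

theorem act_inj (σ : Equiv.Perm (Fin r)) : Function.Injective (act (k := k) σ) := by
  intro S T h
  have h1 : S.1.image σ = T.1.image σ := congrArg Subtype.val h
  exact Subtype.ext (Finset.image_injective σ.injective h1)

theorem YM_ext {v w : YM F r k} (h : ∀ S, ev F S v = ev F S w) : v = w :=
  Finsupp.ext h

theorem End_ext {f g : Module.End F (YM F r k)}
    (h : ∀ S S', ev F S' (f (bs F S)) = ev F S' (g (bs F S))) : f = g := by
  have : ∀ S, f (bs F S) = g (bs F S) := fun S => YM_ext (h S)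
  exact Finsupp.lhom_ext' (fun S => LinearMap.ext_ring (this S))

theorem permEnd_bs (σ : Equiv.Perm (Fin r)) (S : Idx r k) :
    permEnd F r k σ (bs F S) = bs F (act σ S) :=
  Finsupp.mapDomain_single

theorem ev_permEnd (σ : Equiv.Perm (Fin r)) (S : Idx r k) (v : YM F r k) :
    ev F (act σ S) (permEnd F r k σ v) = ev F S v :=
  Finsupp.mapDomain_apply (act_inj σ) v S

theorem ev_vv (t : Finset (Fin r)) (S : Idx r k) :
    ev F S (vv F r k t) = if t = S.1 then 1 else 0 := by
  by_cases h : t.card = k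
  · have hv : vv F r k t = bs F ⟨t, h⟩ := dif_pos h
    rw [hv]
    by_cases h1 : t = S.1
    · have : S = ⟨t, h⟩ := Subtype.ext h1.symm
      rw [if_pos h1, this]
      exact Finsupp.single_eq_same
    · rw [if_neg h1]
      refine Finsupp.single_eq_of_ne (fun h2 => h1 ?_)
      rw [h2]
  · have hv : vv F r k t = 0 := dif_neg h
    rw [hv, if_neg (fun h1 : t = S.1 => h (h1 ▸ S.2)), map_zero]

theorem bRaw_bs (a : ℕ) (S : Idx r k) :
    bRaw F r k a (bs F S) = ∑ W ∈ Finset.powersetCard a (S.1ᶜ),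
      ∑ T ∈ Finset.powersetCard a (S.1 ∪ W), vv F r k ((S.1 ∪ W) \ T) := by
  unfold bRaw bs
  erw [Finsupp.lift_apply, Finsupp.sum_single_index]
  · rw [one_smul]
  · rw [zero_smul]

/-- only triangularity info is needed, plus dependence on distance -/
theorem coef_b (a : ℕ) (S S' : Idx r k) :
    ev F S' (bRaw F r k a (bs F S)) =
      (((Finset.powersetCard a (S.1ᶜ)).filter (fun W => S'.1 \ S.1 ⊆ W)).card : F) := by
  rw [bRaw_bs, map_sum, Finset.card_filter, Nat.cast_sum]
  refine Finset.sum_congr rfl fun W hW => ?_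
  rw [Finset.mem_powersetCard] at hW
  have hd : Disjoint S.1 W := by
    rw [Finset.disjoint_left]; intro x hx hxW
    exact (Finset.mem_compl.1 (hW.1 hxW)) hx
  have hc : (S.1 ∪ W).card = k + a := by
    rw [Finset.card_union_of_disjoint hd, S.2, hW.2]
  simp only [map_sum, ev_vv]
  have hiff : S'.1 \ S.1 ⊆ W ↔ S'.1 ⊆ S.1 ∪ W := by
    exact sdiff_le_iff
  split_ifs with h
  · rw [hiff] at h
    rw [Finset.sum_eq_single ((S.1 ∪ W) \ S'.1)]
    · simp [Finset.inter_eq_right.2 h]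
    · intro T hT hne
      rw [Finset.mem_powersetCard] at hT
      rw [if_neg]
      intro he
      apply hne
      rw [← he, Finset.sdiff_sdiff_eq_self hT.1]
    · intro hn
      exfalso; apply hn
      rw [Finset.mem_powersetCard]
      refine ⟨Finset.sdiff_subset, ?_⟩
      rw [Finset.card_sdiff_of_subset h, hc, S'.2]; omega
  · rw [Nat.cast_zero]
    refine Finset.sum_eq_zero fun T hT => if_neg fun he => h ?_
    rw [hiff, ← he]; exact Finset.sdiff_subset

theorem coef_diag (a : ℕ) (S S' : Idx r k) (h : (S'.1 \ S.1).card = a) :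
    ev F S' (bRaw F r k a (bs F S)) = 1 := by
  rw [coef_b]
  have : ((Finset.powersetCard a (S.1ᶜ)).filter (fun W => S'.1 \ S.1 ⊆ W)) = {S'.1 \ S.1} := by
    ext W
    simp only [Finset.mem_filter, Finset.mem_powersetCard, Finset.mem_singleton]
    constructor
    · rintro ⟨⟨h1, h2⟩, h3⟩
      exact (Finset.eq_of_subset_of_card_le h3 (by omega)).symm
    · rintro rfl
      exact ⟨⟨fun x hx => by simp at hx ⊢; exact hx.2, h⟩, subset_rfl⟩
  rw [this]; simp

theorem coef_zero (a : ℕ) (S S' : Idx r k) (h : a < (S'.1 \ S.1).card) :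
    ev F S' (bRaw F r k a (bs F S)) = 0 := by
  rw [coef_b, Finset.filter_eq_empty_iff.2]; · simp
  intro W hW h3
  rw [Finset.mem_powersetCard] at hW
  have := Finset.card_le_card h3
  omega

theorem img_compl (σ : Equiv.Perm (Fin r)) (S : Finset (Fin r)) :
    Sᶜ.image σ = (S.image σ)ᶜ := by
  ext x
  obtain ⟨y, rfl⟩ := σ.surjective x
  simp

theorem coef_act (a : ℕ) (σ : Equiv.Perm (Fin r)) (S S' : Idx r k) :
    ev F (act σ S') (bRaw F r k a (bs F (act σ S))) = ev F S' (bRaw F r k a (bs F S)) := by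
  rw [coef_b, coef_b]
  congr 1
  symm
  refine Finset.card_bij (fun W _ => W.image σ) ?_ ?_ ?_
  · intro W hW
    simp only [Finset.mem_filter, Finset.mem_powersetCard] at hW ⊢
    refine ⟨⟨?_, ?_⟩, ?_⟩
    · change _ ⊆ (S.1.image σ)ᶜ
      rw [← img_compl σ]
      exact Finset.image_subset_image hW.1.1
    · rw [Finset.card_image_of_injective _ σ.injective]; exact hW.1.2
    · change S'.1.image σ \ S.1.image σ ⊆ _
      rw [← Finset.image_sdiff _ _ σ.injective]
      exact Finset.image_subset_image hW.2
  · intro W _ W' _ h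
    exact Finset.image_injective σ.injective h
  · intro W hW
    simp only [Finset.mem_filter, Finset.mem_powersetCard] at hW
    have hWW : (W.image σ.symm).image σ = W := by
      rw [Finset.image_image]; simp
    refine ⟨W.image σ.symm, ?_, hWW⟩
    obtain ⟨⟨h1, h2⟩, h3⟩ := hW
    simp only [Finset.mem_filter, Finset.mem_powersetCard]
    rw [← hWW] at h1 h3
    refine ⟨⟨?_, ?_⟩, ?_⟩
    · change _ ⊆ (S.1.image σ)ᶜ at h1
      rw [← img_compl σ] at h1
      exact (Finset.image_subset_image_iff σ.injective).1 h1
    · rw [Finset.card_image_of_injective _ σ.symm.injective]; exact h2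
    · change S'.1.image σ \ S.1.image σ ⊆ _ at h3
      rw [← Finset.image_sdiff _ _ σ.injective] at h3
      exact (Finset.image_subset_image_iff σ.injective).1 h3

theorem act_surj (σ : Equiv.Perm (Fin r)) : Function.Surjective (act (k := k) σ) :=
  Finite.surjective_of_injective (act_inj σ)

theorem b_mem (a : ℕ) : bRaw F r k a ∈ SF F r k := by
  rw [SF, Subalgebra.mem_centralizer_iff]
  rintro _ ⟨σ, rfl⟩
  refine End_ext fun S S' => ?_
  obtain ⟨T, rfl⟩ := act_surj σ S'
  rw [Module.End.mul_apply, Module.End.mul_apply, ev_permEnd, permEnd_bs, coef_act]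

theorem SF_act {f : Module.End F (YM F r k)} (hf : f ∈ SF F r k) (σ : Equiv.Perm (Fin r))
    (S S' : Idx r k) :
    ev F (act σ S') (f (bs F (act σ S))) = ev F S' (f (bs F S)) := by
  rw [SF, Subalgebra.mem_centralizer_iff] at hf
  have := hf _ ⟨σ, rfl⟩
  rw [← permEnd_bs, ← Module.End.mul_apply, ← this, Module.End.mul_apply, ev_permEnd]

theorem card_fib (S S' : Idx r k) (c : Bool × Bool) :
    Fintype.card {x : Fin r // (decide (x ∈ S.1), decide (x ∈ S'.1)) = c} =
      match c with
      | (true, true) => k - (S'.1 \ S.1).card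
      | (true, false) => (S'.1 \ S.1).card
      | (false, true) => (S'.1 \ S.1).card
      | (false, false) => r - k - (S'.1 \ S.1).card := by
  have e1 := Finset.card_sdiff_add_card_inter S'.1 S.1
  have e2 := Finset.card_sdiff_add_card_inter S.1 S'.1
  have e3 := Finset.card_union_add_card_inter S.1 S'.1
  have e4 := Finset.card_compl (S.1 ∪ S'.1)
  rw [Finset.inter_comm] at e1
  rw [S.2] at e2 e3
  rw [S'.2] at e1 e3
  rw [Fintype.card_fin] at e4
  rw [Fintype.card_subtype]
  rcases c with ⟨_ | _, _ | _⟩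
  · rw [show (Finset.univ.filter fun x => (decide (x ∈ S.1), decide (x ∈ S'.1)) = (false, false))
      = (S.1 ∪ S'.1)ᶜ by ext x; simp]
    dsimp only; omega
  · rw [show (Finset.univ.filter fun x => (decide (x ∈ S.1), decide (x ∈ S'.1)) = (false, true))
      = S'.1 \ S.1 by ext x; simp [and_comm]]
  · rw [show (Finset.univ.filter fun x => (decide (x ∈ S.1), decide (x ∈ S'.1)) = (true, false))
      = S.1 \ S'.1 by ext x; simp]
    dsimp only; omega
  · rw [show (Finset.univ.filter fun x => (decide (x ∈ S.1), decide (x ∈ S'.1)) = (true, true))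
      = S.1 ∩ S'.1 by ext x; simp]
    dsimp only; omega

theorem exists_perm (S S' U U' : Idx r k) (h : (S'.1 \ S.1).card = (U'.1 \ U.1).card) :
    ∃ σ : Equiv.Perm (Fin r), act σ S = U ∧ act σ S' = U' := by
  have e : ∀ c : Bool × Bool,
      Nonempty ({x : Fin r // (decide (x ∈ S.1), decide (x ∈ S'.1)) = c} ≃
        {x : Fin r // (decide (x ∈ U.1), decide (x ∈ U'.1)) = c}) := fun c => by
    rw [← Fintype.card_eq, card_fib, card_fib, h]
  replace e := fun c => Classical.choice (e c)
  let σ : Equiv.Perm (Fin r) := Equiv.ofFiberEquiv e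
  have hσ : ∀ x, (decide (σ x ∈ U.1), decide (σ x ∈ U'.1)) =
      (decide (x ∈ S.1), decide (x ∈ S'.1)) := fun x => Equiv.ofFiberEquiv_map e x
  simp only [Prod.mk.injEq, decide_eq_decide] at hσ
  refine ⟨σ, Subtype.ext ?_, Subtype.ext ?_⟩
  · refine Finset.eq_of_subset_of_card_le ?_ ?_
    · intro y hy
      obtain ⟨x, hx, rfl⟩ := Finset.mem_image.1 hy
      exact (hσ x).1.2 hx
    · rw [U.2, (act σ S).2]
  · refine Finset.eq_of_subset_of_card_le ?_ ?_
    · intro y hy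
      obtain ⟨x, hx, rfl⟩ := Finset.mem_image.1 hy
      exact (hσ x).2.2 hx
    · rw [U'.2, (act σ S').2]

theorem exists_dist (h : k + k ≤ r) :
    ∃ (S : Idx r k) (D : Fin (k + 1) → Idx r k), ∀ d, ((D d).1 \ S.1).card = d := by
  obtain ⟨S, -, hS⟩ := Finset.exists_subset_card_eq
    (s := (Finset.univ : Finset (Fin r))) (n := k) (by simp; omega)
  refine ⟨⟨S, hS⟩, ?_⟩
  suffices H : ∀ d : Fin (k + 1), ∃ T : Idx r k, (T.1 \ S).card = d by
    choose D hD using H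
    exact ⟨D, hD⟩
  intro d
  have hd := d.2
  obtain ⟨A, hA, hAc⟩ := Finset.exists_subset_card_eq (s := S) (n := k - d) (by omega)
  obtain ⟨B, hB, hBc⟩ := Finset.exists_subset_card_eq (s := Sᶜ) (n := d)
    (by rw [Finset.card_compl, hS, Fintype.card_fin]; omega)
  have hBS : Disjoint B S := by
    rw [Finset.disjoint_left]; intro x hx
    exact Finset.mem_compl.1 (hB hx)
  have hAB : Disjoint A B := (hBS.mono_right hA).symm
  refine ⟨⟨A ∪ B, by rw [Finset.card_union_of_disjoint hAB]; omega⟩, ?_⟩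
  change ((A ∪ B) \ S).card = _
  rw [Finset.union_sdiff_distrib, Finset.sdiff_eq_empty_iff_subset.2 hA, Finset.empty_union,
    Finset.sdiff_eq_self_of_disjoint hBS, hBc]

theorem main (F : Type*) [Field F] (r k : ℕ) (h : k + k ≤ r) :
    LinearIndependent F (fun i : Fin (k + 1) => bRaw F r k (i : ℕ)) ∧
    Submodule.span F (Set.range (fun i : Fin (k + 1) => bRaw F r k (i : ℕ)))
      = Subalgebra.toSubmodule (SF F r k) ∧
    Module.finrank F (Subalgebra.toSubmodule (SF F r k)) = k + 1 := by
  obtain ⟨S, D, hD⟩ := exists_dist h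
  let E : Module.End F (YM F r k) →ₗ[F] (Fin (k + 1) → F) :=
    LinearMap.pi fun d => (ev F (D d)).comp (LinearMap.applyₗ (bs F S))
  have hE : ∀ f d, E f d = ev F (D d) (f (bs F S)) := fun f d => rfl
  have hli : LinearIndependent F (fun i : Fin (k + 1) => bRaw F r k (i : ℕ)) := by
    refine LinearIndependent.of_comp E ?_
    let M : Matrix (Fin (k + 1)) (Fin (k + 1)) F := fun i => E (bRaw F r k i)
    change LinearIndependent F M.row
    rw [Matrix.linearIndependent_rows_iff_isUnit, Matrix.isUnit_iff_isUnit_det,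
      Matrix.det_of_isLowerTriangular]
    · rw [Finset.prod_eq_one]
      · exact isUnit_one
      · intro i _
        exact coef_diag _ _ _ (hD i)
    · intro i j hij
      exact coef_zero _ _ _ (by rw [hD]; exact hij)
  have hinj : Function.Injective (E.comp (Subalgebra.toSubmodule (SF F r k)).subtype) := by
    rw [← LinearMap.ker_eq_bot, LinearMap.ker_eq_bot']
    rintro ⟨f, hf⟩ h0
    have h0 : E f = 0 := h0
    have hf : f ∈ SF F r k := hf
    refine Subtype.ext (End_ext fun U U' => ?_)
    have hlt : (U'.1 \ U.1).card < k + 1 := by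
      have := Finset.card_le_card (Finset.sdiff_subset (s := U'.1) (t := U.1))
      rw [U'.2] at this; omega
    obtain ⟨σ, hσ, hσ'⟩ := exists_perm S (D ⟨_, hlt⟩) U U' (hD _)
    change ev F U' (f (bs F U)) = _
    have key := SF_act hf σ S (D ⟨_, hlt⟩)
    rw [hσ, hσ'] at key
    rw [key, ← hE, h0]
    simp
  have hfin : Module.Finite F (Subalgebra.toSubmodule (SF F r k)) :=
    Module.Finite.of_injective _ hinj
  have hle : Module.finrank F (Subalgebra.toSubmodule (SF F r k)) ≤ k + 1 := by
    have := LinearMap.finrank_le_finrank_of_injective hinj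
    simpa using this
  have hsub : Submodule.span F (Set.range (fun i : Fin (k + 1) => bRaw F r k (i : ℕ)))
      ≤ Subalgebra.toSubmodule (SF F r k) := by
    rw [Submodule.span_le]
    rintro _ ⟨i, rfl⟩
    exact b_mem _
  have hspan := finrank_span_eq_card hli
  rw [Fintype.card_fin] at hspan
  have heq := Submodule.eq_of_le_of_finrank_le hsub (by omega)
  exact ⟨hli, heq, by rw [← heq]; exact hspan⟩

end Aux

set_option synthInstance.maxHeartbeats 1000000 in
/-- `{b(i) : 0 ≤ i ≤ λ₂}` is an `F`-basis of `S_F(λ)`;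
in particular `dim_F S_F(λ) = λ₂ + 1`. -/
theorem stmt1 (F : Type*) [Field F] (r l1 l2 : ℕ) (hl : l2 ≤ l1) (hr : l1 + l2 = r) :
    (∀ i : ℕ, i ≤ l2 → bOp F r l2 i ∈ SF F r l2) ∧
    LinearIndependent F (fun i : Fin (l2 + 1) => bOp F r l2 (i : ℕ)) ∧
    Submodule.span F (Set.range (fun i : Fin (l2 + 1) => bOp F r l2 (i : ℕ)))
      = Subalgebra.toSubmodule (SF F r l2) ∧
    Module.finrank F (SF F r l2) = l2 + 1 := by
  have hb : ∀ i : ℕ, i ≤ l2 → bOp F r l2 i = bRaw F r l2 i := fun i hi => if_pos hi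
  have hb' : (fun i : Fin (l2 + 1) => bOp F r l2 (i : ℕ)) =
      fun i : Fin (l2 + 1) => bRaw F r l2 (i : ℕ) :=
    funext fun i => hb _ (by omega)
  obtain ⟨h1, h2, h3⟩ := Aux.main F r l2 (by omega)
  refine ⟨fun i hi => ?_, ?_, ?_, h3⟩
  · rw [hb i hi]; exact Aux.b_mem i
  · rw [hb']; exact h1
  · rw [hb']; exact h2
end

section
/- For any field F and any partition λ = (λ₁, λ₂) of r with at most two parts, the endomorphism algebra S_F(λ) = End_{FS_r}(M^λ) is commutative, and b(0) is its identity element. -/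
open Finset

/-- For two finsets of equal size there is a permutation swapping them. -/
theorem exists_swap_perm {r : ℕ} (S T : Finset (Fin r)) (h : S.card = T.card) :
    ∃ σ : Equiv.Perm (Fin r), S.image σ = T ∧ T.image σ = S := by
  classical
  have hc : (S \ T).card = (T \ S).card := by
    have h1 := Finset.card_sdiff_add_card_inter S T
    have h2 := Finset.card_sdiff_add_card_inter T S
    rw [Finset.inter_comm] at h2
    omega
  let e : {x // x ∈ S \ T} ≃ {x // x ∈ T \ S} := Finset.equivOfCardEq hc
  let f : Fin r → Fin r := fun x =>
    if h : x ∈ S \ T then (e ⟨x, h⟩ : Fin r)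
    else if h : x ∈ T \ S then (e.symm ⟨x, h⟩ : Fin r) else x
  have f1 : ∀ x (h : x ∈ S \ T), f x = e ⟨x, h⟩ := fun x h => by simp only [f, dif_pos h]
  have f2 : ∀ x (h : x ∈ T \ S), f x = e.symm ⟨x, h⟩ := fun x h => by
    have h' : x ∉ S \ T := by
      simp only [Finset.mem_sdiff] at h ⊢
      tauto
    simp only [f, dif_neg h', dif_pos h]
  have f3 : ∀ x, x ∉ S \ T → x ∉ T \ S → f x = x := fun x h h' => by
    simp only [f, dif_neg h', dif_neg h]
  have hf : Function.Involutive f := by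
    intro x
    by_cases h : x ∈ S \ T
    · rw [f1 x h, f2 _ (e ⟨x, h⟩).2]
      simp
    · by_cases h' : x ∈ T \ S
      · rw [f2 x h', f1 _ (e.symm ⟨x, h'⟩).2]
        simp
      · rw [f3 x h h', f3 x h h']
  have hST : ∀ x ∈ S, f x ∈ T := by
    intro x hx
    by_cases h : x ∈ T
    · rw [f3 x (by simp [h]) (by simp [hx])]; exact h
    · have h' : x ∈ S \ T := by simp [h, hx]
      rw [f1 x h']
      exact (Finset.mem_sdiff.1 (e ⟨x, h'⟩).2).1
  have hTS : ∀ x ∈ T, f x ∈ S := by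
    intro x hx
    by_cases h : x ∈ S
    · rw [f3 x (by simp [hx]) (by simp [h])]; exact h
    · have h' : x ∈ T \ S := by simp [h, hx]
      rw [f2 x h']
      exact (Finset.mem_sdiff.1 (e.symm ⟨x, h'⟩).2).1
  refine ⟨hf.toPerm, ?_, ?_⟩
  · ext y
    simp only [Finset.mem_image, Function.Involutive.coe_toPerm]
    exact ⟨fun ⟨x, hx, hy⟩ => hy ▸ hST x hx, fun hy => ⟨f y, hTS y hy, hf y⟩⟩
  · ext y
    simp only [Finset.mem_image, Function.Involutive.coe_toPerm]
    exact ⟨fun ⟨x, hx, hy⟩ => hy ▸ hTS x hx, fun hy => ⟨f y, hST y hy, hf y⟩⟩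

/-- Basis vector of `YM`. -/
noncomputable def bas (F : Type*) [Field F] (r k : ℕ) (S : Idx r k) : YM F r k :=
  (Finsupp.single S 1 : Idx r k →₀ F)

/-- Coefficient functional on `YM`. -/
noncomputable def cof (F : Type*) [Field F] (r k : ℕ) (T : Idx r k) : YM F r k →ₗ[F] F :=
  (Finsupp.lapply T : (Idx r k →₀ F) →ₗ[F] F)

theorem end_ext {F : Type*} [Field F] {r k : ℕ} {x y : Module.End F (YM F r k)}
    (h : ∀ S T, cof F r k T (x (bas F r k S)) = cof F r k T (y (bas F r k S))) : x = y := by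
  refine Finsupp.lhom_ext' (M := F) (N := YM F r k) (R := F) (α := Idx r k) fun S => ?_
  refine LinearMap.ext_ring ?_
  exact Finsupp.ext fun T => h S T

theorem expand {F : Type*} [Field F] {r k : ℕ} (v : YM F r k) :
    v = ∑ U : Idx r k, cof F r k U v • bas F r k U := by
  have h := Finsupp.univ_sum_single (α := Idx r k) (M := F) v
  refine h.symm.trans (Finset.sum_congr rfl fun U _ => ?_)
  have h2 := Finsupp.smul_single_one (R := F) U (cof F r k U v)
  exact h2.symm

theorem cof_symm {F : Type*} [Field F] {r k : ℕ} {x : Module.End F (YM F r k)}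
    (hx : x ∈ SF F r k) (S T : Idx r k) :
    cof F r k T (x (bas F r k S)) = cof F r k S (x (bas F r k T)) := by
  obtain ⟨σ, h1, h2⟩ := exists_swap_perm S.1 T.1 (S.2.trans T.2.symm)
  have hc : permEnd F r k σ * x = x * permEnd F r k σ :=
    (Subalgebra.mem_centralizer_iff F).1 hx _ ⟨σ, rfl⟩
  have hb : permEnd F r k σ (bas F r k S) = bas F r k T := by
    refine (Finsupp.mapDomain_single).trans ?_
    have : (⟨S.1.image σ, by rw [Finset.card_image_of_injective _ σ.injective]; exact S.2⟩ :
      Idx r k) = T := Subtype.ext h1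
    exact congrArg (fun U => (Finsupp.single U 1 : Idx r k →₀ F)) this
  have hv : ∀ v, cof F r k S (permEnd F r k σ v) = cof F r k T v := by
    intro v
    have hi : Function.Injective (fun S : Idx r k =>
        (⟨S.1.image σ, by rw [Finset.card_image_of_injective _ σ.injective]; exact S.2⟩ :
          Idx r k)) := by
      intro A B hAB
      exact Subtype.ext (Finset.image_injective σ.injective (congrArg Subtype.val hAB))
    have h := Finsupp.mapDomain_apply (M := F) hi v T
    have hT : (⟨T.1.image σ, by rw [Finset.card_image_of_injective _ σ.injective]; exact T.2⟩ :
      Idx r k) = S := Subtype.ext h2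
    beta_reduce at h
    rw [hT] at h
    exact h
  have := LinearMap.congr_fun hc (bas F r k S)
  rw [Module.End.mul_apply, Module.End.mul_apply, hb] at this
  rw [← this, hv]

theorem cof_mul {F : Type*} [Field F] {r k : ℕ} (x y : Module.End F (YM F r k))
    (S T : Idx r k) : cof F r k T ((x * y) (bas F r k S)) =
      ∑ U : Idx r k, cof F r k U (y (bas F r k S)) * cof F r k T (x (bas F r k U)) := by
  rw [Module.End.mul_apply]
  conv_lhs => rw [expand (y (bas F r k S))]
  simp only [map_sum, map_smul, smul_eq_mul]

/-- `S_F(λ)` is commutative and `b(0)` is its identity element. -/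
theorem stmt3 (F : Type*) [Field F] (r l1 l2 : ℕ) (hl : l2 ≤ l1) (hr : l1 + l2 = r) :
    (∀ x y : Module.End F (YM F r l2), x ∈ SF F r l2 → y ∈ SF F r l2 → x * y = y * x) ∧
    bOp F r l2 0 = 1 := by
  constructor
  · intro x y hx hy
    refine end_ext fun S T => ?_
    rw [cof_symm ((SF F r l2).mul_mem hx hy), cof_mul, cof_mul]
    refine Finset.sum_congr rfl fun U _ => ?_
    rw [cof_symm hx U S, cof_symm hy T U, mul_comm]
  · refine Finsupp.lhom_ext' (M := F) (N := YM F r l2) (R := F) (α := Idx r l2) fun S => ?_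
    refine LinearMap.ext_ring ?_
    change bOp F r l2 0 (bas F r l2 S) = bas F r l2 S
    rw [bOp, if_pos (Nat.zero_le _), bRaw]
    refine (Finsupp.lift_apply _ _ _ _ _).trans ?_
    rw [bas, Finsupp.sum_single_index (by exact zero_smul F _)]
    rw [one_smul]
    simp only [Finset.powersetCard_zero, Finset.sum_singleton, Finset.union_empty,
      Finset.sdiff_empty]
    exact dif_pos S.2
end

section
/- Let p be a prime, F a field of characteristic p, λ = (λ₁, λ₂) a partition of r, and i ∈ ℕ₀ with i ≤ λ₂, with p-adic expansion i = Σ_t i_t·p^t. Then in S_F(λ): b(i) = Π_t b(i_t·p^t), a finite product in the commutative algebra S_F(λ) (note that each i_t·p^t ≤ i ≤ λ₂, and factors with i_t = 0 equal the identity b(0)). -/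
open Finset

noncomputable section

/-- Inclusion matrix: adding `a` elements. -/
def upM (F : Type*) [Field F] (r a : ℕ) : Matrix (Finset (Fin r)) (Finset (Fin r)) F :=
  fun S' S => if S ⊆ S' ∧ (S' \ S).card = a then 1 else 0

/-- Transposed inclusion matrix: removing `a` elements. -/
def dnM (F : Type*) [Field F] (r a : ℕ) : Matrix (Finset (Fin r)) (Finset (Fin r)) F :=
  (upM F r a).transpose

/-- Matrix of `b(a)` on all subsets. -/
def bM (F : Type*) [Field F] (r a : ℕ) : Matrix (Finset (Fin r)) (Finset (Fin r)) F :=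
  dnM F r a * upM F r a

theorem upM_mul_upM (F : Type*) [Field F] (r a c : ℕ) :
    upM F r a * upM F r c = ((Nat.choose (a + c) c : ℕ) : F) • upM F r (a + c) := by
  ext S' S
  rw [Matrix.mul_apply, Matrix.smul_apply]
  simp only [upM, smul_eq_mul, mul_ite, mul_one, mul_zero, ← ite_and]
  rw [Finset.sum_boole]
  split_ifs with h
  · congr 1
    rw [← h.2, ← Finset.card_powersetCard]
    symm
    refine Finset.card_bij' (fun W _ => S ∪ W) (fun R _ => R \ S) ?_ ?_ ?_ ?_
    · intro W hW
      rw [Finset.mem_powersetCard] at hW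
      have hd : Disjoint W S := Finset.disjoint_of_subset_left hW.1 Finset.sdiff_disjoint
      have e1 : (S ∪ W) \ S = W := by
        rw [Finset.union_sdiff_left]; exact Finset.sdiff_eq_self_of_disjoint hd
      have hsub : S ∪ W ⊆ S' := Finset.union_subset h.1 (hW.1.trans Finset.sdiff_subset)
      simp only [Finset.mem_filter, Finset.mem_univ, true_and]
      refine ⟨⟨Finset.subset_union_left, by rw [e1]; exact hW.2⟩, hsub, ?_⟩
      have := Finset.card_sdiff_add_card_eq_card hsub
      have h3 := Finset.card_sdiff_add_card_eq_card h.1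
      have h4 := Finset.card_union_of_disjoint hd.symm
      omega
    · intro R hR
      simp only [Finset.mem_filter, Finset.mem_univ, true_and] at hR
      rw [Finset.mem_powersetCard]
      exact ⟨Finset.sdiff_subset_sdiff hR.2.1 le_rfl, hR.1.2⟩
    · intro W hW
      rw [Finset.mem_powersetCard] at hW
      have hd : Disjoint W S := Finset.disjoint_of_subset_left hW.1 Finset.sdiff_disjoint
      rw [Finset.union_sdiff_left]; exact Finset.sdiff_eq_self_of_disjoint hd
    · intro R hR
      simp only [Finset.mem_filter, Finset.mem_univ, true_and] at hR
      exact Finset.union_sdiff_of_subset hR.1.1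
  · rw [← Nat.cast_zero (R := F)]
    congr 1
    rw [Finset.card_eq_zero, Finset.filter_eq_empty_iff]
    rintro R - ⟨⟨h1, h2⟩, h3, h4⟩
    apply h
    refine ⟨h1.trans h3, ?_⟩
    have := Finset.card_sdiff_add_card_eq_card h1
    have := Finset.card_sdiff_add_card_eq_card h3
    have := Finset.card_sdiff_add_card_eq_card (h1.trans h3)
    omega

theorem dnM_mul_dnM (F : Type*) [Field F] (r a c : ℕ) :
    dnM F r a * dnM F r c = ((Nat.choose (a + c) a : ℕ) : F) • dnM F r (a + c) := by
  rw [dnM, dnM, ← Matrix.transpose_mul, upM_mul_upM, Matrix.transpose_smul, add_comm c a, dnM]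

theorem upM_mul_dnM_apply (F : Type*) [Field F] (r a c : ℕ) (S' S : Finset (Fin r))
    (hc : c ≤ S.card) :
    (upM F r a * dnM F r c) S' S =
      if S'.card + c = S.card + a then ((Nat.choose (S ∩ S').card (S.card - c) : ℕ) : F)
      else 0 := by
  rw [Matrix.mul_apply]
  simp only [upM, dnM, Matrix.transpose_apply, mul_ite, mul_one, mul_zero, ← ite_and]
  rw [Finset.sum_boole]
  split_ifs with h
  · congr 1
    rw [← Finset.card_powersetCard]
    congr 1
    ext R
    simp only [Finset.mem_filter, Finset.mem_univ, true_and, Finset.mem_powersetCard,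
      Finset.subset_inter_iff]
    constructor
    · rintro ⟨⟨h1, h2⟩, h3, h4⟩
      have := Finset.card_sdiff_add_card_eq_card h1
      exact ⟨⟨h1, h3⟩, by omega⟩
    · rintro ⟨⟨h1, h3⟩, h2⟩
      have := Finset.card_sdiff_add_card_eq_card h1
      have := Finset.card_sdiff_add_card_eq_card h3
      exact ⟨⟨h1, by omega⟩, h3, by omega⟩
  · rw [← Nat.cast_zero (R := F)]
    congr 1
    rw [Finset.card_eq_zero, Finset.filter_eq_empty_iff]
    rintro R - ⟨⟨h1, h2⟩, h3, h4⟩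
    have := Finset.card_sdiff_add_card_eq_card h1
    have := Finset.card_sdiff_add_card_eq_card h3
    omega

theorem dnM_mul_upM_apply (F : Type*) [Field F] (r a c : ℕ) (S' S : Finset (Fin r))
    (hc : S.card + a ≤ r) :
    (dnM F r c * upM F r a) S' S =
      if S'.card + c = S.card + a then
        ((Nat.choose (r - (S ∪ S').card) (r - S.card - a) : ℕ) : F)
      else 0 := by
  rw [Matrix.mul_apply]
  simp only [upM, dnM, Matrix.transpose_apply, mul_ite, mul_one, mul_zero, ← ite_and]
  rw [Finset.sum_boole]
  have hcc : ∀ R : Finset (Fin r), Rᶜ.card + R.card = r := fun R => by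
    have := Finset.card_compl_add_card R
    rwa [Fintype.card_fin] at this
  split_ifs with h
  · congr 1
    have hu : r - (S ∪ S').card = ((S ∪ S')ᶜ).card := by
      have := hcc (S ∪ S'); omega
    rw [hu, ← Finset.card_powersetCard]
    refine Finset.card_bij' (fun R _ => Rᶜ) (fun R _ => Rᶜ) ?_ ?_ ?_ ?_
    · intro R hR
      simp only [Finset.mem_filter, Finset.mem_univ, true_and] at hR
      obtain ⟨⟨h1, h2⟩, h3, h4⟩ := hR
      rw [Finset.mem_powersetCard, Finset.compl_subset_compl]
      have := Finset.card_sdiff_add_card_eq_card h1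
      have := hcc R
      exact ⟨Finset.union_subset h1 h3, by omega⟩
    · intro R hR
      rw [Finset.mem_powersetCard] at hR
      simp only [Finset.mem_filter, Finset.mem_univ, true_and]
      have h0 : S ∪ S' ⊆ Rᶜ := by
        rw [Finset.subset_compl_comm]; exact hR.1
      have h1 := Finset.subset_union_left.trans h0
      have h3 := Finset.subset_union_right.trans h0
      have := Finset.card_sdiff_add_card_eq_card h1
      have := Finset.card_sdiff_add_card_eq_card h3
      have := hcc R
      exact ⟨⟨h1, by omega⟩, h3, by omega⟩
    · intro R _; exact compl_compl R
    · intro R _; exact compl_compl R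
  · rw [← Nat.cast_zero (R := F)]
    congr 1
    rw [Finset.card_eq_zero, Finset.filter_eq_empty_iff]
    rintro R - ⟨⟨h1, h2⟩, h3, h4⟩
    have := Finset.card_sdiff_add_card_eq_card h1
    have := Finset.card_sdiff_add_card_eq_card h3
    omega

theorem vand (I A B Q M : ℕ) (hQ : Q + A = I + B) (hM : I ≤ A + M) :
    ((Nat.choose I A : ℕ) : ℤ) =
      ∑ t ∈ Finset.range (M + 1), Ring.choose ((A : ℤ) - B) t * (Nat.choose Q (B + t) : ℕ) := by
  by_cases hA : A ≤ I
  · obtain ⟨q, rfl⟩ := Nat.exists_eq_add_of_le hA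
    obtain rfl : Q = B + q := by omega
    have hv := Ring.add_choose_eq q (Commute.all ((A : ℤ) - B) ((B + q : ℕ) : ℤ))
    have e : (A : ℤ) - B + ((B + q : ℕ) : ℤ) = ((A + q : ℕ) : ℤ) := by push_cast; ring
    rw [e, Ring.choose_natCast, Finset.Nat.sum_antidiagonal_eq_sum_range_succ
      (fun x y => Ring.choose ((A : ℤ) - B) x * Ring.choose ((B + q : ℕ) : ℤ) y)] at hv
    rw [show (A + q).choose A = (A + q).choose q from Nat.choose_symm_add, hv]
    have hsub : Finset.range (q + 1) ⊆ Finset.range (M + 1) := by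
      apply Finset.range_subset_range.2; omega
    rw [← Finset.sum_subset hsub]
    · apply Finset.sum_congr rfl
      intro t ht
      rw [Finset.mem_range] at ht
      rw [Ring.choose_natCast]
      congr 2
      apply Nat.choose_symm_of_eq_add
      omega
    · intro t _ ht
      rw [Finset.mem_range] at ht
      rw [Nat.choose_eq_zero_of_lt (by omega)]
      simp
  · rw [Nat.choose_eq_zero_of_lt (by omega), Finset.sum_eq_zero]
    · simp
    · intro t _
      rw [Nat.choose_eq_zero_of_lt (by omega)]
      simp

theorem comm_rel (F : Type*) [Field F] (r a c : ℕ) (S' S : Finset (Fin r))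
    (hc : c ≤ S.card) (ha : S.card + a ≤ r) :
    (upM F r a * dnM F r c) S' S =
      ∑ t ∈ Finset.range (min a c + 1),
        ((Ring.choose (((S.card - c : ℕ) : ℤ) - ((r - S.card - a : ℕ) : ℤ)) t : ℤ) : F) *
          (dnM F r (c - t) * upM F r (a - t)) S' S := by
  rw [upM_mul_dnM_apply F r a c S' S hc]
  have h1 : ∀ t ∈ Finset.range (min a c + 1),
      (dnM F r (c - t) * upM F r (a - t)) S' S =
      if S'.card + c = S.card + a then
        ((Nat.choose (r - (S ∪ S').card) (r - S.card - a + t) : ℕ) : F)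
      else 0 := by
    intro t ht
    rw [Finset.mem_range] at ht
    rw [dnM_mul_upM_apply F r (a - t) (c - t) S' S (by omega)]
    have e : r - S.card - (a - t) = r - S.card - a + t := by omega
    rw [e]
    by_cases h : S'.card + c = S.card + a
    · rw [if_pos h, if_pos (by omega)]
    · rw [if_neg h, if_neg (by omega)]
  rw [Finset.sum_congr rfl (fun t ht => by rw [h1 t ht])]
  split_ifs with h
  · have hui := Finset.card_union_add_card_inter S S'
    have hu : (S ∪ S').card ≤ r := by simpa using Finset.card_le_univ (S ∪ S')
    have hi1 := Finset.card_le_card (Finset.inter_subset_left : S ∩ S' ⊆ S)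
    have hi2 := Finset.card_le_card (Finset.inter_subset_right : S ∩ S' ⊆ S')
    have := vand (S ∩ S').card (S.card - c) (r - S.card - a) (r - (S ∪ S').card) (min a c)
      (by omega) (by omega)
    have h2 := congrArg (Int.cast : ℤ → F) this
    push_cast at h2
    rw [h2]
  · simp

theorem bM_mul_apply (F : Type*) [Field F] (r a c : ℕ) (S' S : Finset (Fin r))
    (ha : S.card + a + c ≤ r)
    (h0 : ((Nat.choose (a + c) a : ℕ) : F) = 1)
    (h1 : ∀ t, 0 < t → t ≤ a → t ≤ c →
      ((Nat.choose (a + c - t) a : ℕ) : F) * ((Nat.choose (a + c - t) c : ℕ) : F) = 0) :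
    (bM F r a * bM F r c) S' S = bM F r (a + c) S' S := by
  have e : bM F r a * bM F r c = dnM F r a * ((upM F r a * dnM F r c) * upM F r c) := by
    simp only [bM, Matrix.mul_assoc]
  set x : ℕ → F := fun t =>
    ((Ring.choose (((S.card + c - c : ℕ) : ℤ) - ((r - (S.card + c) - a : ℕ) : ℤ)) t : ℤ) : F)
    with hx
  have key : ∀ R, ((upM F r a * dnM F r c) * upM F r c) R S =
      ((∑ t ∈ Finset.range (min a c + 1), x t • (dnM F r (c - t) * upM F r (a - t)))
        * upM F r c) R S := by
    intro R
    rw [Matrix.mul_apply, Matrix.mul_apply]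
    apply Finset.sum_congr rfl
    intro V _
    by_cases hV : S ⊆ V ∧ (V \ S).card = c
    · have := Finset.card_sdiff_add_card_eq_card hV.1
      have hVc : V.card = S.card + c := by omega
      rw [comm_rel F r a c R V (by omega) (by omega), hVc]
      simp only [Matrix.sum_apply, Matrix.smul_apply, smul_eq_mul, hx]
    · have : upM F r c V S = 0 := by rw [upM, if_neg hV]
      rw [this, mul_zero, mul_zero]
  have e2 : (bM F r a * bM F r c) S' S = (dnM F r a *
      ((∑ t ∈ Finset.range (min a c + 1), x t • (dnM F r (c - t) * upM F r (a - t)))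
        * upM F r c)) S' S := by
    rw [e, Matrix.mul_apply, Matrix.mul_apply]
    exact Finset.sum_congr rfl (fun R _ => by rw [key R])
  rw [e2]
  rw [Finset.sum_mul, Finset.mul_sum]
  have e3 : ∀ t ∈ Finset.range (min a c + 1),
      dnM F r a * (x t • (dnM F r (c - t) * upM F r (a - t)) * upM F r c) =
      (x t * (((Nat.choose (a + c - t) a : ℕ) : F) * ((Nat.choose (a + c - t) c : ℕ) : F))) •
        bM F r (a + c - t) := by
    intro t ht
    rw [Finset.mem_range] at ht
    have : dnM F r a * (x t • (dnM F r (c - t) * upM F r (a - t)) * upM F r c) =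
      x t • ((dnM F r a * dnM F r (c - t)) * (upM F r (a - t) * upM F r c)) := by
      simp only [Matrix.smul_mul, Matrix.mul_smul, Matrix.mul_assoc]
    rw [this, dnM_mul_dnM, upM_mul_upM, show a + (c - t) = a + c - t by omega,
      show a - t + c = a + c - t by omega, Matrix.smul_mul, Matrix.mul_smul, smul_smul, smul_smul,
      bM, mul_assoc]
  rw [Finset.sum_congr rfl e3, Finset.sum_eq_single 0]
  · have hx0 : x 0 = 1 := by simp [hx]
    have hs : ((Nat.choose (a + c) c : ℕ) : F) = 1 := by
      rw [← h0]; congr 1; exact Nat.choose_symm_add.symm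
    rw [hx0, Nat.sub_zero, h0, hs, one_mul, one_mul, one_smul]
  · intro t ht ht0
    rw [Finset.mem_range] at ht
    rw [h1 t (by omega) (by omega) (by omega), mul_zero, zero_smul]
  · intro h; simp at h

/-- Coordinate functional on `YM`. -/
def coordYM (F : Type*) [Field F] (r k : ℕ) (S : Idx r k) : YM F r k →ₗ[F] F :=
  (Finsupp.lapply S : (Idx r k →₀ F) →ₗ[F] F)

/-- Basis vector of `YM`. -/
def basYM (F : Type*) [Field F] (r k : ℕ) (S : Idx r k) : YM F r k :=
  (Finsupp.single S 1 : Idx r k →₀ F)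

theorem vv_pos (F : Type*) [Field F] (r k : ℕ) (t : Finset (Fin r)) (h : t.card = k) :
    vv F r k t = basYM F r k ⟨t, h⟩ := dif_pos h

theorem vv_neg (F : Type*) [Field F] (r k : ℕ) (t : Finset (Fin r)) (h : ¬ t.card = k) :
    vv F r k t = 0 := dif_neg h

theorem vv_apply (F : Type*) [Field F] (r k : ℕ) (t : Finset (Fin r)) (S' : Idx r k) :
    coordYM F r k S' (vv F r k t) = if t = S'.1 then 1 else 0 := by
  by_cases h : t.card = k
  · rw [vv_pos F r k t h]
    by_cases h2 : t = S'.1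
    · rw [if_pos h2]; subst h2; exact Finsupp.single_eq_same
    · rw [if_neg h2]
      exact Finsupp.single_eq_of_ne (fun hh => h2 (by rw [hh]))
  · rw [vv_neg F r k t h, if_neg (fun h2 : t = S'.1 => h (by rw [h2]; exact S'.2)), map_zero]

theorem bM_apply_eq (F : Type*) [Field F] (r a : ℕ) (S' S : Finset (Fin r)) :
    bM F r a S' S = ∑ W ∈ Finset.powersetCard a (Sᶜ),
      ∑ T ∈ Finset.powersetCard a (S ∪ W), if (S ∪ W) \ T = S' then (1 : F) else 0 := by
  have hin : ∀ R : Finset (Fin r),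
      (∑ T ∈ Finset.powersetCard a R, if R \ T = S' then (1 : F) else 0) = dnM F r a S' R := by
    intro R
    rw [dnM, Matrix.transpose_apply, upM]
    split_ifs with h
    · rw [Finset.sum_eq_single (R \ S')]
      · rw [if_pos]; exact Finset.sdiff_sdiff_eq_self h.1
      · intro T hT hne
        rw [Finset.mem_powersetCard] at hT
        rw [if_neg]
        rintro rfl
        exact hne (Finset.sdiff_sdiff_eq_self hT.1).symm
      · intro hn
        exact absurd (Finset.mem_powersetCard.2 ⟨Finset.sdiff_subset, h.2⟩) hn
    · apply Finset.sum_eq_zero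
      intro T hT
      rw [Finset.mem_powersetCard] at hT
      rw [if_neg]
      rintro rfl
      exact h ⟨Finset.sdiff_subset, by rw [Finset.sdiff_sdiff_eq_self hT.1]; exact hT.2⟩
  simp only [hin]
  rw [bM, Matrix.mul_apply]
  simp only [upM, mul_ite, mul_one, mul_zero]
  rw [← Finset.sum_filter]
  symm
  refine Finset.sum_bij' (fun W _ => S ∪ W) (fun R _ => R \ S) ?_ ?_ ?_ ?_ ?_
  · intro W hW
    rw [Finset.mem_powersetCard] at hW
    have hd : Disjoint W S := by
      rw [← Finset.subset_compl_iff_disjoint_right]; exact hW.1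
    simp only [Finset.mem_filter, Finset.mem_univ, true_and]
    refine ⟨Finset.subset_union_left, ?_⟩
    rw [Finset.union_sdiff_left, Finset.sdiff_eq_self_of_disjoint hd]; exact hW.2
  · intro R hR
    simp only [Finset.mem_filter, Finset.mem_univ, true_and] at hR
    rw [Finset.mem_powersetCard]
    refine ⟨?_, hR.2⟩
    rw [Finset.subset_compl_iff_disjoint_right]
    exact Finset.sdiff_disjoint
  · intro W hW
    rw [Finset.mem_powersetCard] at hW
    have hd : Disjoint W S := by
      rw [← Finset.subset_compl_iff_disjoint_right]; exact hW.1
    rw [Finset.union_sdiff_left]; exact Finset.sdiff_eq_self_of_disjoint hd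
  · intro R hR
    simp only [Finset.mem_filter, Finset.mem_univ, true_and] at hR
    exact Finset.union_sdiff_of_subset hR.1
  · intro W _; rfl

theorem bM_apply_zero (F : Type*) [Field F] (r a : ℕ) (S' S : Finset (Fin r))
    (h : S'.card ≠ S.card) : bM F r a S' S = 0 := by
  rw [bM, Matrix.mul_apply]
  apply Finset.sum_eq_zero
  intro R _
  simp only [upM, dnM, Matrix.transpose_apply, mul_ite, mul_one, mul_zero, ← ite_and]
  rw [if_neg]
  rintro ⟨⟨h1, h2⟩, h3, h4⟩
  have := Finset.card_sdiff_add_card_eq_card h1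
  have := Finset.card_sdiff_add_card_eq_card h3
  omega

theorem extYM (F : Type*) [Field F] (r k : ℕ) (f g : Module.End F (YM F r k))
    (h : ∀ S S', coordYM F r k S' (f (basYM F r k S)) = coordYM F r k S' (g (basYM F r k S))) :
    f = g := by
  have : ∀ S, f (basYM F r k S) = g (basYM F r k S) := fun S =>
    Finsupp.ext (fun S' => h S S')
  exact Finsupp.lhom_ext' (M := F) (fun S => LinearMap.ext_ring (this S))

theorem coord_bRaw (F : Type*) [Field F] (r k a : ℕ) (S S' : Idx r k) :
    coordYM F r k S' (bRaw F r k a (basYM F r k S)) = bM F r a S'.1 S.1 := by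
  have : bRaw F r k a (basYM F r k S) = ∑ W ∈ Finset.powersetCard a (S.1ᶜ),
      ∑ T ∈ Finset.powersetCard a (S.1 ∪ W), vv F r k ((S.1 ∪ W) \ T) := by
    unfold bRaw basYM
    erw [Finsupp.lift_apply, Finsupp.sum_single_index] <;> simp
  rw [this, bM_apply_eq]
  simp only [map_sum]
  refine Finset.sum_congr rfl fun W _ => Finset.sum_congr rfl fun T _ => ?_
  exact vv_apply F r k _ S'

theorem expandYM (F : Type*) [Field F] (r k : ℕ) (v : YM F r k) :
    v = ∑ S, coordYM F r k S v • basYM F r k S := by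
  have := Finsupp.univ_sum_single (show Idx r k →₀ F from v)
  refine this.symm.trans (Finset.sum_congr rfl fun S _ => ?_)
  have h := Finsupp.smul_single (coordYM F r k S v) S (1 : F)
  rw [smul_eq_mul, mul_one] at h
  exact h.symm

theorem bRaw_mul (F : Type*) [Field F] (r k a c : ℕ)
    (ha : k + a + c ≤ r)
    (h0 : ((Nat.choose (a + c) a : ℕ) : F) = 1)
    (h1 : ∀ t, 0 < t → t ≤ a → t ≤ c →
      ((Nat.choose (a + c - t) a : ℕ) : F) * ((Nat.choose (a + c - t) c : ℕ) : F) = 0) :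
    bRaw F r k a * bRaw F r k c = bRaw F r k (a + c) := by
  apply extYM
  intro S S'
  rw [coord_bRaw, ← bM_mul_apply F r a c S'.1 S.1 (by rw [S.2]; exact ha) h0 h1,
    Module.End.mul_apply, expandYM F r k (bRaw F r k c (basYM F r k S))]
  simp only [map_sum, map_smul, coord_bRaw, smul_eq_mul]
  rw [Matrix.mul_apply]
  have : ∑ R : Finset (Fin r), bM F r a S'.1 R * bM F r c R S.1 =
      ∑ R ∈ Finset.univ.filter (fun R : Finset (Fin r) => R.card = k),
        bM F r a S'.1 R * bM F r c R S.1 := by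
    symm
    apply Finset.sum_subset (Finset.filter_subset _ _)
    intro R _ hR
    rw [bM_apply_zero F r c R S.1, mul_zero]
    intro hh
    apply hR
    rw [Finset.mem_filter]
    exact ⟨Finset.mem_univ _, hh.trans S.2⟩
  rw [this, Finset.sum_subtype (p := fun R : Finset (Fin r) => R.card = k)
    (F := inferInstance) _ (by simp)]
  exact Finset.sum_congr rfl fun R _ => mul_comm _ _

theorem bRaw_zero (F : Type*) [Field F] (r k : ℕ) : bRaw F r k 0 = 1 := by
  apply extYM
  intro S S'
  rw [coord_bRaw, bM_apply_eq, Module.End.one_apply]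
  simp only [Finset.powersetCard_zero, Finset.sum_singleton, Finset.union_empty,
    Finset.sdiff_empty]
  have := vv_apply F r k S.1 S'
  rw [← this, vv_pos F r k S.1 S.2]

theorem lucasF (F : Type*) [Field F] (p : ℕ) (hp : p.Prime) [CharP F p] (u x y d e : ℕ)
    (hx : x < p ^ u) (hy : y < p ^ u) :
    ((Nat.choose (x + p ^ u * d) (y + p ^ u * e) : ℕ) : F) =
      ((Nat.choose x y : ℕ) : F) * ((Nat.choose d e : ℕ) : F) := by
  have := Fact.mk hp
  have hpos := hp.pos
  induction u generalizing x y with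
  | zero =>
    have : x = 0 := by simpa using hx
    have : y = 0 := by simpa using hy
    subst x y
    simp
  | succ u ih =>
    have step : ∀ n m : ℕ, ((Nat.choose n m : ℕ) : F) =
        ((Nat.choose (n % p) (m % p) : ℕ) : F) * ((Nat.choose (n / p) (m / p) : ℕ) : F) := by
      intro n m
      have := (CharP.natCast_eq_natCast F p).2
        (Choose.choose_modEq_choose_mod_mul_choose_div_nat (n := n) (k := m) (p := p))
      rw [this]; push_cast; rfl
    have em : ∀ z w : ℕ, (z + p ^ (u + 1) * w) % p = z % p := by
      intro z w
      rw [pow_succ', mul_assoc, Nat.add_mul_mod_self_left]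
    have ed : ∀ z w : ℕ, (z + p ^ (u + 1) * w) / p = z / p + p ^ u * w := by
      intro z w
      rw [pow_succ', mul_assoc, Nat.add_mul_div_left _ _ hpos]
    rw [step, em, em, ed, ed, ih _ _ (by rw [Nat.div_lt_iff_lt_mul hpos, ← pow_succ]; exact hx)
      (by rw [Nat.div_lt_iff_lt_mul hpos, ← pow_succ]; exact hy), step x y, mul_assoc]

theorem bOp_prod (F : Type*) [Field F] (p : ℕ) (hp : p.Prime) [CharP F p]
    (r l2 i : ℕ) (hi : i ≤ l2) (hr : l2 + l2 ≤ r) (N : ℕ) :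
    bOp F r l2 (i % p ^ N) =
        ((List.range N).map (fun t => bOp F r l2 (digit p i t * p ^ t))).prod := by
  induction N with
  | zero => simp [bOp, Nat.mod_one, bRaw_zero]
  | succ N ih =>
    have hm : i % p ^ (N + 1) = i % p ^ N + p ^ N * (digit p i N) := by
      rw [digit]; exact Nat.mod_pow_succ
    rw [List.range_succ, List.map_append, List.prod_append, ← ih]
    simp only [List.map_cons, List.map_nil, List.prod_cons, List.prod_nil, mul_one]
    have hle : i % p ^ (N + 1) ≤ l2 := (Nat.mod_le _ _).trans hi
    rw [hm] at hle ⊢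
    have hlt : i % p ^ N < p ^ N := Nat.mod_lt _ (pow_pos hp.pos N)
    rw [mul_comm (digit p i N)]
    generalize i % p ^ N = a at *
    generalize digit p i N = d at *
    rw [bOp, bOp, bOp, if_pos hle, if_pos (by omega), if_pos (by omega)]
    symm
    apply bRaw_mul
    · omega
    · have := lucasF F p hp N a a d 0 hlt hlt
      simpa using this
    · intro t ht hta _
      have := lucasF F p hp N (a - t) a d 0 (by omega) hlt
      rw [Nat.choose_eq_zero_of_lt (show a - t < a by omega)] at this
      rw [show a + p ^ N * d - t = a - t + p ^ N * d by omega]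
      rw [mul_zero, add_zero] at this
      rw [this]
      simp

end

/-- for `char F = p` and `i ≤ λ₂` with `p`-adic digits `i_t`,
`b(i) = Π_t b(i_t·p^t)` (a finite product: over any range `N` with `i < p^N`). -/
theorem stmt4 (F : Type*) [Field F] (p : ℕ) (hp : p.Prime) [CharP F p]
    (r l1 l2 : ℕ) (hl : l2 ≤ l1) (hr : l1 + l2 = r) (i : ℕ) (hi : i ≤ l2) :
    ∀ N : ℕ, i < p ^ N →
      bOp F r l2 i =
        ((List.range N).map (fun t => bOp F r l2 (digit p i t * p ^ t))).prod := by
  intro N hN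
  have := bOp_prod F p hp r l2 i hi (by omega) N
  rwa [Nat.mod_eq_of_lt hN] at this
end

section
/- Let F be a field of characteristic 3, λ = (λ₁, λ₂) a partition of r, and u ∈ ℕ with 3^u ≤ λ₂. Then the F-linear span of {b(k) : 0 ≤ k < 3^u} is closed under composition, i.e., it is a unital subalgebra of S_F(λ). -/
open Finset

theorem aux_choose_dvd (u i k : ℕ) (hi : i < 3 ^ u) (hk : 3 ^ u ≤ k) (hk2 : k < 3 ^ u + i) :
    3 ∣ Nat.choose k i := by
  obtain ⟨k', rfl⟩ := Nat.exists_eq_add_of_le hk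
  rw [Nat.add_choose_eq]
  apply Finset.dvd_sum
  rintro ⟨a, b⟩ hab
  rw [Finset.HasAntidiagonal.mem_antidiagonal] at hab
  simp only at hab ⊢
  by_cases ha : a = 0
  · rw [Nat.choose_eq_zero_of_lt (show k' < b by omega)]; simp
  · exact Dvd.dvd.mul_right (Nat.Prime.dvd_choose_pow Nat.prime_three ha (by omega)) _

theorem aux_count {α : Type*} [DecidableEq α] [Fintype α] (P Q : Finset α) (hPQ : P ⊆ Q) (n : ℕ) :
    (univ.filter (fun X : Finset α => P ⊆ X ∧ X ⊆ Q ∧ X.card = P.card + n)).card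
      = (Q.card - P.card).choose n := by
  rw [← Finset.card_sdiff_of_subset hPQ, ← Finset.card_powersetCard]
  apply Finset.card_bij' (fun X _ => X \ P) (fun Y _ => P ∪ Y)
  · intro X hX
    simp only [mem_filter, mem_univ, true_and] at hX
    rw [mem_powersetCard, Finset.card_sdiff_of_subset hX.1]
    exact ⟨Finset.sdiff_subset_sdiff hX.2.1 (Finset.Subset.refl _), by omega⟩
  · intro Y hY
    rw [mem_powersetCard] at hY
    simp only [mem_filter, mem_univ, true_and]
    refine ⟨subset_union_left, union_subset hPQ (hY.1.trans sdiff_subset), ?_⟩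
    rw [card_union_of_disjoint, hY.2]
    exact disjoint_sdiff.mono_right hY.1
  · intro X hX
    simp only [mem_filter, mem_univ, true_and] at hX
    simp [hX.1]
  · intro Y hY
    rw [mem_powersetCard] at hY
    rw [union_sdiff_cancel_left]
    exact disjoint_sdiff.mono_right hY.1

/-- number of supersets -/
def NN (r l : ℕ) (k : ℕ) (S S' : Finset (Fin r)) : ℤ :=
  ∑ X : Finset (Fin r), if S ⊆ X ∧ S' ⊆ X ∧ X.card = l + k then 1 else 0

theorem aux_inner (r l i j : ℕ) (X Y : Finset (Fin r)) (hX : X.card = l + i) (hY : Y.card = l + j) :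
    (((X ∩ Y).card.choose l : ℕ) : ℤ) = ∑ t ∈ range (i + j + 1),
      Ring.choose (2 * l + i + j - r : ℤ) t * NN r l (i + j - t) X Y := by
  have hun := Finset.card_union_add_card_inter X Y
  have hle : (X ∪ Y).card ≤ r := by simpa using Finset.card_le_univ (X ∪ Y)
  have hi1 : (X ∩ Y).card ≤ l + i := hX ▸ card_le_card inter_subset_left
  have hNN : ∀ t ∈ range (i + j + 1), NN r l (i + j - t) X Y =
      if l + t ≤ (X ∩ Y).card then
        (((r - (X ∪ Y).card).choose ((X ∩ Y).card - l - t) : ℕ) : ℤ) else 0 := by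
    intro t ht
    rw [mem_range] at ht
    unfold NN
    rw [Finset.sum_boole]
    split_ifs with h
    · have := aux_count (X ∪ Y) univ (subset_univ _) ((X ∩ Y).card - l - t)
      rw [Finset.card_univ, Fintype.card_fin] at this
      rw [← this]
      congr 2
      ext Z
      simp only [mem_filter, mem_univ, true_and, union_subset_iff, subset_univ]
      have : (X ∪ Y).card + ((X ∩ Y).card - l - t) = l + (i + j - t) := by omega
      rw [this]; tauto
    · norm_cast
      rw [Finset.card_eq_zero, Finset.filter_eq_empty_iff]
      rintro Z - ⟨h1, h2, h3⟩
      have := card_le_card (union_subset h1 h2)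
      omega
  rw [Finset.sum_congr rfl (fun t ht => by rw [hNN t ht])]
  by_cases hl : l ≤ (X ∩ Y).card
  · have hV := Ring.add_choose_eq ((X ∩ Y).card - l)
      (Commute.all (2 * l + i + j - r : ℤ) ((r - (X ∪ Y).card : ℕ) : ℤ))
    have hs : (2 * l + i + j - r : ℤ) + ((r - (X ∪ Y).card : ℕ) : ℤ) = ((X ∩ Y).card : ℕ) := by
      omega
    rw [hs, Ring.choose_natCast, Nat.choose_symm hl] at hV
    rw [hV, Finset.Nat.sum_antidiagonal_eq_sum_range_succ_mk]
    simp only [Ring.choose_natCast]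
    symm
    rw [← Finset.sum_subset (s₁ := range ((X ∩ Y).card - l).succ)]
    · apply Finset.sum_congr rfl
      intro t ht
      rw [mem_range] at ht
      rw [if_pos (by omega)]
    · intro t ht
      rw [mem_range] at *
      omega
    · intro t ht ht'
      rw [mem_range] at *
      rw [if_neg (by omega)]; simp
  · rw [Nat.choose_eq_zero_of_lt (by omega)]
    symm
    apply Finset.sum_eq_zero
    intro t ht
    rw [if_neg (by omega)]; simp

theorem aux_mid (r l k j : ℕ) (S Z : Finset (Fin r)) (hS : S.card = l) (hZ : Z.card = l + k) :
    (∑ Y : Finset (Fin r), if S ⊆ Y ∧ Y.card = l + j ∧ Y ⊆ Z then (1:ℤ) else 0)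
      = if S ⊆ Z then ((k.choose j : ℕ) : ℤ) else 0 := by
  split_ifs with h
  · have := aux_count S Z h j
    rw [hS, hZ, Nat.add_sub_cancel_left] at this
    rw [Finset.sum_boole, ← this]
    congr 2
    ext Y; simp only [mem_filter, mem_univ, true_and]; tauto
  · apply Finset.sum_eq_zero
    intro Y _
    rw [if_neg]
    rintro ⟨h1, -, h2⟩
    exact h (h1.trans h2)

theorem aux_S (r l : ℕ) (X Y : Finset (Fin r)) :
    (∑ S : Idx r l, if S.1 ⊆ X ∧ S.1 ⊆ Y then (1:ℤ) else 0) = (((X ∩ Y).card.choose l : ℕ) : ℤ) := by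
  rw [Finset.sum_boole, ← Finset.card_powersetCard]
  congr 1
  apply Finset.card_bij (fun S _ => S.1)
  · intro S hS
    simp only [mem_filter, mem_univ, true_and] at hS
    rw [mem_powersetCard]
    exact ⟨subset_inter hS.1 hS.2, S.2⟩
  · intro a _ b _ h
    exact Subtype.ext h
  · intro T hT
    rw [mem_powersetCard, subset_inter_iff] at hT
    exact ⟨⟨T, hT.2⟩, by simpa using hT.1, rfl⟩

theorem aux_main (r l i j : ℕ) (S S'' : Idx r l) :
    ∑ S' : Idx r l, NN r l j S.1 S'.1 * NN r l i S'.1 S''.1 =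
      ∑ t ∈ range (i + j + 1), (Ring.choose (2 * l + i + j - r : ℤ) t *
        ((i + j - t).choose i : ℕ) * ((i + j - t).choose j : ℕ)) * NN r l (i + j - t) S.1 S''.1 := by
  have h1 : ∑ S' : Idx r l, NN r l j S.1 S'.1 * NN r l i S'.1 S''.1 =
      ∑ Y : Finset (Fin r), ∑ X : Finset (Fin r),
        if (S.1 ⊆ Y ∧ Y.card = l + j) ∧ (S''.1 ⊆ X ∧ X.card = l + i) then
          (((X ∩ Y).card.choose l : ℕ) : ℤ) else 0 := by
    unfold NN
    simp_rw [Finset.sum_mul_sum]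
    rw [Finset.sum_comm]
    refine Finset.sum_congr rfl fun Y _ => ?_
    rw [Finset.sum_comm]
    refine Finset.sum_congr rfl fun X _ => ?_
    rw [← aux_S]
    split_ifs with h
    · refine Finset.sum_congr rfl fun S' _ => ?_
      simp only [h, ite_and, true_and, and_true]
      split_ifs <;> simp
    · refine Finset.sum_eq_zero fun S' _ => ?_
      by_cases h1 : S.1 ⊆ Y ∧ Y.card = l + j
      · have h2 : ¬ (S'.1 ⊆ X ∧ S''.1 ⊆ X ∧ X.card = l + i) := by tauto
        rw [if_neg h2, mul_zero]
      · have h2 : ¬ (S.1 ⊆ Y ∧ S'.1 ⊆ Y ∧ Y.card = l + j) := by tauto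
        rw [if_neg h2, zero_mul]
  have h2 : ∀ X Y : Finset (Fin r), (if (S.1 ⊆ Y ∧ Y.card = l + j) ∧ (S''.1 ⊆ X ∧ X.card = l + i) then
          (((X ∩ Y).card.choose l : ℕ) : ℤ) else 0) =
      ∑ t ∈ range (i + j + 1), ∑ Z : Finset (Fin r), 
        Ring.choose (2 * l + i + j - r : ℤ) t * 
        ((if Z.card = l + (i + j - t) then 1 else 0) * 
        ((if S.1 ⊆ Y ∧ Y.card = l + j ∧ Y ⊆ Z then (1:ℤ) else 0) *
        (if S''.1 ⊆ X ∧ X.card = l + i ∧ X ⊆ Z then (1:ℤ) else 0))) := by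
    intro X Y
    split_ifs with h
    · rw [aux_inner r l i j X Y h.2.2 h.1.2]
      refine Finset.sum_congr rfl fun t _ => ?_
      rw [← Finset.mul_sum]
      congr 1
      unfold NN
      refine Finset.sum_congr rfl fun Z _ => ?_
      simp only [h, true_and, ite_and]
      split_ifs <;> simp
    · symm
      refine Finset.sum_eq_zero fun t _ => Finset.sum_eq_zero fun Z _ => ?_
      have : ¬ (S.1 ⊆ Y ∧ Y.card = l + j ∧ Y ⊆ Z) ∨ ¬ (S''.1 ⊆ X ∧ X.card = l + i ∧ X ⊆ Z) := by
        tauto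
      rcases this with h | h <;> rw [if_neg h] <;> simp
  rw [h1]
  simp_rw [h2]
  rw [Finset.sum_congr rfl (fun Y _ => Finset.sum_comm), Finset.sum_comm]
  refine Finset.sum_congr rfl fun t _ => ?_
  rw [Finset.sum_congr rfl (fun Y _ => Finset.sum_comm), Finset.sum_comm]
  rw [mul_assoc, mul_assoc]
  simp_rw [← Finset.mul_sum]
  congr 1
  unfold NN
  simp_rw [← Finset.sum_mul]
  rw [Finset.mul_sum, Finset.mul_sum]
  refine Finset.sum_congr rfl fun Z _ => ?_
  by_cases hZ : Z.card = l + (i + j - t)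
  · rw [aux_mid r l _ j _ _ S.2 hZ, aux_mid r l _ i _ _ S''.2 hZ]
    simp only [hZ, ite_and]
    split_ifs <;> simp [mul_comm]
  · simp [hZ]

/-- basis vector of the permutation module -/
noncomputable def ee (F : Type*) [Field F] (r l : ℕ) (S : Idx r l) : YM F r l :=
  (Finsupp.single S 1 : Idx r l →₀ F)

theorem aux_vv (F : Type*) [Field F] (r l : ℕ) (S : Idx r l) :
    vv F r l S.1 = ee F r l S := by
  unfold vv
  exact dif_pos S.2

theorem aux_bRaw0 (F : Type*) [Field F] (r l a : ℕ) (S : Idx r l) :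
    bRaw F r l a (ee F r l S) = ∑ W ∈ Finset.powersetCard a (S.1ᶜ),
      ∑ T ∈ Finset.powersetCard a (S.1 ∪ W), vv F r l ((S.1 ∪ W) \ T) := by
  unfold bRaw ee
  refine (Finsupp.lift_apply _ _ _ _ _).trans ?_
  rw [Finsupp.sum_single_index] <;> simp

theorem aux_ext (F : Type*) [Field F] (r l : ℕ) (f g : Module.End F (YM F r l))
    (h : ∀ S, f (ee F r l S) = g (ee F r l S)) : f = g := by
  have : (f : (Idx r l →₀ F) →ₗ[F] YM F r l) = g := by
    apply Finsupp.lhom_ext'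
    intro S
    apply LinearMap.ext_ring
    exact h S
  exact this

theorem aux_T (F : Type*) [Field F] (r l a : ℕ) (X : Finset (Fin r)) (hX : X.card = l + a) :
    ∑ T ∈ powersetCard a X, vv F r l (X \ T) =
      ∑ S' : Idx r l, if S'.1 ⊆ X then ee F r l S' else 0 := by
  rw [← Finset.sum_filter]
  symm
  apply Finset.sum_bij (fun S' _ => X \ S'.1)
  · intro S' hS
    rw [mem_filter] at hS
    rw [mem_powersetCard, card_sdiff_of_subset hS.2, S'.2]
    exact ⟨sdiff_subset, by omega⟩
  · intro A hA B hB h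
    rw [mem_filter] at hA hB
    apply Subtype.ext
    rw [← Finset.sdiff_sdiff_eq_self hA.2, h, Finset.sdiff_sdiff_eq_self hB.2]
  · intro T hT
    rw [mem_powersetCard] at hT
    refine ⟨⟨X \ T, ?_⟩, ?_, ?_⟩
    · rw [card_sdiff_of_subset hT.1]; omega
    · rw [mem_filter]; exact ⟨mem_univ _, sdiff_subset⟩
    · exact Finset.sdiff_sdiff_eq_self hT.1
  · intro S' hS
    rw [mem_filter] at hS
    rw [Finset.sdiff_sdiff_eq_self hS.2]
    exact (aux_vv F r l S').symm

theorem aux_bRaw (F : Type*) [Field F] (r l a : ℕ) (S : Idx r l) :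
    bRaw F r l a (ee F r l S) =
      ∑ S' : Idx r l, ((NN r l a S.1 S'.1 : ℤ) : F) • ee F r l S' := by
  rw [aux_bRaw0]
  have h1 : ∑ W ∈ Finset.powersetCard a (S.1ᶜ),
      ∑ T ∈ Finset.powersetCard a (S.1 ∪ W), vv F r l ((S.1 ∪ W) \ T) =
      ∑ X ∈ univ.filter (fun X : Finset (Fin r) => S.1 ⊆ X ∧ X.card = l + a),
        ∑ S' : Idx r l, if S'.1 ⊆ X then ee F r l S' else 0 := by
    apply Finset.sum_bij (fun W _ => S.1 ∪ W)
    · intro W hW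
      rw [mem_powersetCard] at hW
      simp only [mem_filter, mem_univ, true_and]
      refine ⟨subset_union_left, ?_⟩
      rw [card_union_of_disjoint, S.2, hW.2]
      exact disjoint_compl_right.mono_right hW.1
    · intro A hA B hB h
      rw [mem_powersetCard] at hA hB
      have hA' : Disjoint S.1 A := disjoint_compl_right.mono_right hA.1
      have hB' : Disjoint S.1 B := disjoint_compl_right.mono_right hB.1
      rw [← union_sdiff_cancel_left hA', h, union_sdiff_cancel_left hB']
    · intro X hX
      simp only [mem_filter, mem_univ, true_and] at hX
      refine ⟨X \ S.1, ?_, ?_⟩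
      · rw [mem_powersetCard, card_sdiff_of_subset hX.1, S.2]
        refine ⟨?_, by omega⟩
        intro x hx
        rw [mem_sdiff] at hx
        rw [mem_compl]; exact hx.2
      · exact union_sdiff_of_subset hX.1
    · intro W hW
      rw [mem_powersetCard] at hW
      apply aux_T
      rw [card_union_of_disjoint, S.2, hW.2]
      exact disjoint_compl_right.mono_right hW.1
  rw [h1, Finset.sum_comm]
  refine Finset.sum_congr rfl fun S' _ => ?_
  unfold NN
  rw [Int.cast_sum, Finset.sum_smul, Finset.sum_filter]
  refine Finset.sum_congr rfl fun X _ => ?_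
  simp only [ite_and]
  split_ifs <;> simp

theorem aux_mul (F : Type*) [Field F] (r l i j : ℕ) :
    bRaw F r l i * bRaw F r l j = ∑ t ∈ range (i + j + 1),
      ((Ring.choose (2 * l + i + j - r : ℤ) t *
        ((i + j - t).choose i : ℕ) * ((i + j - t).choose j : ℕ) : ℤ) : F) •
          bRaw F r l (i + j - t) := by
  apply aux_ext
  intro S
  rw [Module.End.mul_apply, aux_bRaw, map_sum]
  simp_rw [map_smul, aux_bRaw]
  simp_rw [LinearMap.sum_apply, LinearMap.smul_apply, aux_bRaw, Finset.smul_sum, smul_smul]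
  rw [Finset.sum_comm, Finset.sum_comm (s := range (i + j + 1))]
  refine Finset.sum_congr rfl fun S'' _ => ?_
  simp_rw [← Finset.sum_smul]
  congr 1
  have := congrArg (fun z : ℤ => (z : F)) (aux_main r l i j S S'')
  simp only [Int.cast_sum, Int.cast_mul] at this ⊢
  exact this

theorem aux_one (F : Type*) [Field F] (r l : ℕ) : bRaw F r l 0 = 1 := by
  apply aux_ext
  intro S
  rw [aux_bRaw0]
  simp [aux_vv]

/-- for `char F = 3`, `u ≥ 1`, `3^u ≤ λ₂`, the `F`-span of
`{b(k) : 0 ≤ k < 3^u}` is a unital subalgebra of `S_F(λ)`. -/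
theorem stmt8 (F : Type*) [Field F] [CharP F 3] (r l1 l2 : ℕ) (hl : l2 ≤ l1)
    (hr : l1 + l2 = r) (u : ℕ) (hu1 : 1 ≤ u) (hu : 3 ^ u ≤ l2) :
    (1 : Module.End F (YM F r l2)) ∈
        Submodule.span F {φ : Module.End F (YM F r l2) | ∃ k < 3 ^ u, φ = bOp F r l2 k} ∧
    ∀ x y : Module.End F (YM F r l2),
      x ∈ Submodule.span F {φ : Module.End F (YM F r l2) | ∃ k < 3 ^ u, φ = bOp F r l2 k} →
      y ∈ Submodule.span F {φ : Module.End F (YM F r l2) | ∃ k < 3 ^ u, φ = bOp F r l2 k} →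
      x * y ∈ Submodule.span F {φ : Module.End F (YM F r l2) | ∃ k < 3 ^ u, φ = bOp F r l2 k} := by
  have hb : ∀ k < 3 ^ u, bOp F r l2 k = bRaw F r l2 k := fun k hk => by
    unfold bOp; rw [if_pos (by omega)]
  refine ⟨?_, ?_⟩
  · apply Submodule.subset_span
    exact ⟨0, by positivity, by rw [hb 0 (by positivity), aux_one]⟩
  · intro x y hx hy
    have hxy := Submodule.mul_mem_mul hx hy
    rw [Submodule.span_mul_span] at hxy
    refine (Submodule.span_le.mpr ?_) hxy
    rintro _ ⟨_, ⟨i, hi, rfl⟩, _, ⟨j, hj, rfl⟩, rfl⟩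
    simp only [SetLike.mem_coe]
    rw [hb i hi, hb j hj, aux_mul]
    refine Submodule.sum_mem _ fun t ht => ?_
    by_cases hk : i + j - t < 3 ^ u
    · apply Submodule.smul_mem
      apply Submodule.subset_span
      exact ⟨_, hk, (hb _ hk).symm⟩
    · have hd := aux_choose_dvd u i (i + j - t) hi (by omega) (by omega)
      have hz : (((i + j - t).choose i : ℕ) : F) = 0 := (CharP.cast_eq_zero_iff F 3 _).mpr hd
      simp [hz]
end

section
/- Let p be a prime and m, g ∈ ℕ₀ such that p does not divide the binomial coefficient C(m+2g, g). Then for every u ∈ ℕ₀: (m+2g)_u − 2·g_u ≡ m_u + x_{u−1} (mod p) as integers, where n_u denotes the u-th base-p digit of n and (x_u) is the carry sequence of the p-ary addition of m and g. -/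
open Finset

/-- if `p ∤ C(m+2g, g)` then for every `u`,
`(m+2g)_u − 2·g_u ≡ m_u + x_{u−1} (mod p)`. -/
theorem stmt12 (p : ℕ) (hp : p.Prime) (m g : ℕ) (hB : ¬ (p ∣ Nat.choose (m + 2 * g) g))
    (u : ℕ) :
    (digit p (m + 2 * g) u : ℤ) - 2 * (digit p g u : ℤ) ≡
      (digit p m u : ℤ) + (carry p m g u : ℤ) [ZMOD (p : ℤ)] := by
  have hlt : g % p ^ u + (m + g) % p ^ u < p ^ u := by
    rcases Nat.eq_zero_or_pos u with rfl | hu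
    · simp [Nat.mod_one]
    · have hk := Nat.factorization_choose' (p := p) (n := m + g) (k := g)
        (b := Nat.log p (m + g + g) + u + 1) hp (by omega)
      have e : m + g + g = m + 2 * g := by ring
      rw [e, Nat.factorization_eq_zero_of_not_dvd hB] at hk
      by_contra hcon
      have hmem : u ∈ {i ∈ Finset.Ico 1 (Nat.log p (m + 2 * g) + u + 1) |
          p ^ i ≤ g % p ^ i + (m + g) % p ^ i} := by
        rw [Finset.mem_filter, Finset.mem_Ico]
        exact ⟨⟨hu, by omega⟩, not_lt.mp hcon⟩
      rw [Finset.card_eq_zero.mp hk.symm] at hmem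
      simp at hmem
  have hP : 0 < p ^ u := pow_pos hp.pos u
  have h1 : (m + 2 * g) / p ^ u = g / p ^ u + (m + g) / p ^ u := by
    have e : m + 2 * g = g + (m + g) := by ring
    rw [e, Nat.add_div hP, if_neg (not_le.mpr hlt), add_zero]
  have h2 : (m + g) / p ^ u = m / p ^ u + g / p ^ u + carry p m g u := by
    have hm := Nat.mod_add_div m (p ^ u)
    have hg := Nat.mod_add_div g (p ^ u)
    have e : m + g = (m % p ^ u + g % p ^ u) + p ^ u * (m / p ^ u + g / p ^ u) := by
      rw [mul_add]; omega
    unfold carry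
    conv_lhs => rw [e]
    rw [Nat.add_mul_div_left _ _ hP, add_comm]
  have hd : ∀ n : ℕ, ((digit p n u : ℕ) : ℤ) ≡ ((n / p ^ u : ℕ) : ℤ) [ZMOD (p : ℤ)] := by
    intro n
    unfold digit
    rw [Int.natCast_mod]
    exact Int.mod_modEq _ _
  have hA := (hd (m + 2 * g)).sub ((hd g).mul_left 2)
  have hC := (hd m).add_right (carry p m g u : ℤ)
  refine hA.trans (Int.ModEq.trans ?_ hC.symm)
  rw [h1, h2]
  generalize carry p m g u = c
  push_cast
  refine congrArg (· % (p : ℤ)) ?_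
  ring
end

section
/- Let F be a field of characteristic 3, m ∈ ℕ₀, t ∈ ℕ with t ≥ 1, and let λ = (λ₁, λ₂) be a partition with λ₁ − λ₂ = m and λ₂ ≥ 3^t. Then in S_F(λ): ψ_{m,t} = ψ_{m,t−1}∘( C(m_{t−1}, 2)·1 + m_{t−1}·b(3^{t−1}) + b(2·3^{t−1}) ) + C(m_{t−1}, 2)·b(3^{t−1}) + m_{t−1}·b(2·3^{t−1}), where m_{t−1} is the (t−1)-st ternary digit of m and integer coefficients are interpreted in F. -/
open Finset

/-- Inclusion matrix. -/
noncomputable def Inc (F : Type*) [Field F] (r a b : ℕ) : Matrix (Idx r a) (Idx r b) F :=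
  fun S C => if S.1 ⊆ C.1 then 1 else 0

/-- Matrix of `b(a)`. -/
noncomputable def BM (F : Type*) [Field F] (r k a : ℕ) : Matrix (Idx r k) (Idx r k) F :=
  Inc F r k (k + a) * (Inc F r k (k + a)).transpose

theorem count_between (F : Type*) [Field F] (r b : ℕ) (A B : Finset (Fin r)) (hAB : A ⊆ B)
    (hb : A.card ≤ b) :
    (∑ C : Idx r b, if A ⊆ C.1 ∧ C.1 ⊆ B then (1 : F) else 0)
      = ((Nat.choose (B.card - A.card) (b - A.card) : ℕ) : F) := by
  rw [← Finset.card_sdiff_of_subset hAB, ← Finset.card_powersetCard, Finset.sum_boole]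
  congr 1
  refine Finset.card_bij (fun C _ => C.1 \ A) ?_ ?_ ?_
  · intro C hC
    simp only [Finset.mem_filter, Finset.mem_univ, true_and] at hC
    rw [Finset.mem_powersetCard]
    refine ⟨Finset.sdiff_subset_sdiff hC.2 le_rfl, ?_⟩
    rw [Finset.card_sdiff_of_subset hC.1, C.2]
  · intro C hC C' hC' h
    simp only [Finset.mem_filter, Finset.mem_univ, true_and] at hC hC'
    apply Subtype.ext
    rw [← Finset.sdiff_union_of_subset hC.1, ← Finset.sdiff_union_of_subset hC'.1, h]
  · intro W hW
    rw [Finset.mem_powersetCard] at hW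
    have hd : Disjoint W A := Finset.disjoint_of_subset_left hW.1 Finset.sdiff_disjoint
    refine ⟨⟨W ∪ A, ?_⟩, ?_, ?_⟩
    · rw [Finset.card_union_of_disjoint hd, hW.2]; omega
    · simp only [Finset.mem_filter, Finset.mem_univ, true_and]
      exact ⟨Finset.subset_union_right,
        Finset.union_subset (hW.1.trans Finset.sdiff_subset) hAB⟩
    · simp only
      rw [Finset.union_sdiff_right, Finset.sdiff_eq_self_of_disjoint hd]

theorem inc_mul_inc (F : Type*) [Field F] (r a b c : ℕ) (hab : a ≤ b) :
    Inc F r a b * Inc F r b c = ((Nat.choose (c - a) (b - a) : ℕ) : F) • Inc F r a c := by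
  ext S C
  rw [Matrix.mul_apply, Matrix.smul_apply]
  have h1 : ∀ E : Idx r b, Inc F r a b S E * Inc F r b c E C
      = if S.1 ⊆ E.1 ∧ E.1 ⊆ C.1 then (1 : F) else 0 := by
    intro E
    unfold Inc
    by_cases h : S.1 ⊆ E.1 <;> by_cases h' : E.1 ⊆ C.1 <;> simp [h, h']
  rw [Finset.sum_congr rfl (fun E _ => h1 E)]
  by_cases hSC : S.1 ⊆ C.1
  · rw [count_between F r b S.1 C.1 hSC (by rw [S.2]; exact hab), S.2, C.2]
    simp [Inc, hSC]
  · rw [Finset.sum_eq_zero]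
    · simp [Inc, hSC]
    · intro E _
      rw [if_neg]
      exact fun h => hSC (h.1.trans h.2)

theorem inc_comm (F : Type*) [Field F] (r k i j N : ℕ) (hr : r = k + N + i + j) (hij : i ≤ j) :
    (Inc F r k (k + j)).transpose * Inc F r k (k + i) =
      ∑ p ∈ Finset.range (i + 1), ((Ring.choose ((k : ℤ) - N) p : ℤ) : F) •
        (Inc F r (k + j) (k + (i + j - p)) * (Inc F r (k + i) (k + (i + j - p))).transpose) := by
  ext C C'
  rw [Matrix.sum_apply, Matrix.mul_apply]
  have h1 : ∀ E : Idx r k, (Inc F r k (k + j)).transpose C E * Inc F r k (k + i) E C'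
      = if ∅ ⊆ E.1 ∧ E.1 ⊆ C.1 ∩ C'.1 then (1 : F) else 0 := by
    intro E
    rw [Matrix.transpose_apply]
    unfold Inc
    by_cases h : E.1 ⊆ C.1 <;> by_cases h' : E.1 ⊆ C'.1 <;> simp [h, h', Finset.subset_inter_iff]
  rw [Finset.sum_congr rfl (fun E _ => h1 E),
    count_between F r k ∅ (C.1 ∩ C'.1) (Finset.empty_subset _) (by simp)]
  have hcard := Finset.card_union_add_card_inter C.1 C'.1
  rw [C.2, C'.2] at hcard
  have hur : (C.1 ∪ C'.1).card ≤ r := by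
    simpa using Finset.card_le_univ (C.1 ∪ C'.1)
  have hxi : (C.1 ∩ C'.1).card ≤ k + i := by
    exact (Finset.card_le_card Finset.inter_subset_right).trans C'.2.le
  have h2 : ∀ p, (Inc F r (k + j) (k + (i + j - p)) *
        (Inc F r (k + i) (k + (i + j - p))).transpose) C C' =
      ∑ E : Idx r (k + (i + j - p)),
        if C.1 ∪ C'.1 ⊆ E.1 ∧ E.1 ⊆ Finset.univ then (1 : F) else 0 := by
    intro p
    rw [Matrix.mul_apply]
    refine Finset.sum_congr rfl (fun E _ => ?_)
    rw [Matrix.transpose_apply]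
    unfold Inc
    by_cases h : C.1 ⊆ E.1 <;> by_cases h' : C'.1 ⊆ E.1 <;> simp [h, h', Finset.union_subset_iff]
  have h3 : ∀ p, k + (i + j - p) < (C.1 ∪ C'.1).card →
      (Inc F r (k + j) (k + (i + j - p)) *
        (Inc F r (k + i) (k + (i + j - p))).transpose) C C' = 0 := by
    intro p hp
    rw [h2, Finset.sum_eq_zero]
    intro E _
    rw [if_neg]
    intro h
    have := Finset.card_le_card h.1
    rw [E.2] at this
    omega
  simp only [Finset.card_empty, Nat.sub_zero]
  by_cases hx : (C.1 ∩ C'.1).card < k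
  · rw [Nat.choose_eq_zero_of_lt hx, Finset.sum_eq_zero]
    · simp
    · intro p _
      rw [Matrix.smul_apply, h3 p (by omega), smul_zero]
  · obtain ⟨y, hy⟩ := Nat.exists_eq_add_of_le (not_lt.mp hx)
    have hyi : y ≤ i := by omega
    rw [← Finset.sum_subset (s₁ := Finset.range (y + 1))]
    · have h4 : ∀ p ∈ Finset.range (y + 1),
          (((Ring.choose ((k : ℤ) - N) p : ℤ) : F) •
          (Inc F r (k + j) (k + (i + j - p)) *
            (Inc F r (k + i) (k + (i + j - p))).transpose)) C C' =
          ((Ring.choose ((k : ℤ) - N) p * (Nat.choose (N + y) (y - p) : ℕ) : ℤ) : F) := by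
        intro p hp
        rw [Finset.mem_range] at hp
        rw [Matrix.smul_apply, h2, count_between F r _ _ _ (Finset.subset_univ _) (by omega)]
        rw [Finset.card_univ, Fintype.card_fin]
        have e1 : r - (C.1 ∪ C'.1).card = N + y := by omega
        have e2 : k + (i + j - p) - (C.1 ∪ C'.1).card = y - p := by omega
        rw [e1, e2]
        simp
      rw [Finset.sum_congr rfl h4, ← Int.cast_sum]
      have h5 := Ring.add_choose_eq y (r := (k : ℤ) - N) (s := ((N + y : ℕ) : ℤ))
        (Commute.all _ _)
      rw [Finset.Nat.sum_antidiagonal_eq_sum_range_succ_mk] at h5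
      simp only [Ring.choose_natCast] at h5
      rw [← h5]
      have e3 : (k : ℤ) - N + ((N + y : ℕ) : ℤ) = ((k + y : ℕ) : ℤ) := by push_cast; ring
      rw [e3, Ring.choose_natCast, hy, Nat.choose_symm_add]
      simp
    · intro p hp
      simp only [Finset.mem_range] at hp ⊢
      omega
    · intro p hp hp'
      simp only [Finset.mem_range] at hp hp'
      rw [Matrix.smul_apply, h3 p (by omega), smul_zero]

theorem BM_mul (F : Type*) [Field F] (r k i j N : ℕ) (hr : r = k + N + i + j) (hij : i ≤ j) :
    BM F r k j * BM F r k i =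
      ∑ p ∈ Finset.range (i + 1), (((Ring.choose ((k : ℤ) - N) p : ℤ) : F) *
        ((Nat.choose (i + j - p) j : ℕ) : F) * ((Nat.choose (i + j - p) i : ℕ) : F)) •
          BM F r k (i + j - p) := by
  have h : BM F r k j * BM F r k i = Inc F r k (k + j) *
      ((Inc F r k (k + j)).transpose * Inc F r k (k + i)) * (Inc F r k (k + i)).transpose := by
    simp only [BM, Matrix.mul_assoc]
  rw [h, inc_comm F r k i j N hr hij, Matrix.mul_sum, Matrix.sum_mul]
  refine Finset.sum_congr rfl (fun p _ => ?_)
  have h1 := inc_mul_inc F r k (k + j) (k + (i + j - p)) (by omega)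
  have h2 := inc_mul_inc F r k (k + i) (k + (i + j - p)) (by omega)
  simp only [Nat.add_sub_cancel_left] at h1 h2
  rw [Matrix.mul_smul, Matrix.smul_mul, ← Matrix.mul_assoc, h1, Matrix.mul_assoc,
    ← Matrix.transpose_mul, h2, Matrix.transpose_smul, Matrix.smul_mul, Matrix.mul_smul,
    smul_smul, smul_smul]
  rfl

/-- Basis vector. -/
noncomputable def ev (F : Type*) [Field F] (r k : ℕ) (S : Idx r k) : YM F r k :=
  Finsupp.single S (1 : F)

theorem lift_ev (F : Type*) [Field F] (r k : ℕ) (f : Idx r k → YM F r k) (S : Idx r k) :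
    (Finsupp.lift (YM F r k) F (Idx r k) f : Module.End F (YM F r k)) (ev F r k S) = f S := by
  unfold ev
  erw [Finsupp.lift_apply, Finsupp.sum_single_index]
  · rw [one_smul]
  · rw [zero_smul]

theorem vv_eq_ev (F : Type*) [Field F] (r k : ℕ) (t : Finset (Fin r)) (h : t.card = k) :
    vv F r k t = ev F r k ⟨t, h⟩ := dif_pos h

/-- The endomorphism attached to a matrix. -/
noncomputable def toE (F : Type*) [Field F] (r k : ℕ) (A : Matrix (Idx r k) (Idx r k) F) :
    Module.End F (YM F r k) :=
  Finsupp.lift (YM F r k) F (Idx r k) (fun S => ∑ S' : Idx r k, A S S' •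
    ev F r k S')

theorem toE_single (F : Type*) [Field F] (r k : ℕ) (A : Matrix (Idx r k) (Idx r k) F)
    (S : Idx r k) : toE F r k A (ev F r k S) =
      ∑ S' : Idx r k, A S S' • ev F r k S' := by
  unfold toE
  exact lift_ev F r k _ S

theorem End_ext (F : Type*) [Field F] (r k : ℕ) (f g : Module.End F (YM F r k))
    (h : ∀ S : Idx r k, f (ev F r k S)
      = g (ev F r k S)) : f = g := by
  refine Finsupp.lhom_ext' (M := F) (N := YM F r k) (fun S => ?_)
  refine LinearMap.ext_ring ?_
  exact h S

theorem toE_mul (F : Type*) [Field F] (r k : ℕ) (A B : Matrix (Idx r k) (Idx r k) F) :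
    toE F r k A * toE F r k B = toE F r k (B * A) := by
  apply End_ext
  intro S
  rw [Module.End.mul_apply, toE_single, toE_single, map_sum]
  simp_rw [map_smul, toE_single, Finset.smul_sum, smul_smul]
  rw [Finset.sum_comm]
  refine Finset.sum_congr rfl (fun S' _ => ?_)
  rw [Matrix.mul_apply, Finset.sum_smul]

theorem bRaw_eq (F : Type*) [Field F] (r k a : ℕ) : bRaw F r k a = toE F r k (BM F r k a) := by
  apply End_ext
  intro S
  rw [toE_single]
  unfold bRaw
  refine (lift_ev F r k _ S).trans ?_
  -- inner sums
  have h1 : ∀ W ∈ Finset.powersetCard a (S.1ᶜ),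
      ∑ T ∈ Finset.powersetCard a (S.1 ∪ W), vv F r k ((S.1 ∪ W) \ T) =
      ∑ S' : Idx r k, (if S'.1 ⊆ S.1 ∪ W then (1 : F) else 0) •
        ev F r k S' := by
    intro W hW
    rw [Finset.mem_powersetCard] at hW
    have hd : Disjoint S.1 W :=
      Finset.disjoint_of_subset_right hW.1 disjoint_compl_right
    have hc : (S.1 ∪ W).card = k + a := by
      rw [Finset.card_union_of_disjoint hd, S.2, hW.2]
    simp only [ite_smul, one_smul, zero_smul]
    rw [← Finset.sum_filter]
    refine Finset.sum_bij' (i := fun T hT => (⟨(S.1 ∪ W) \ T, by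
      rw [Finset.mem_powersetCard] at hT
      rw [Finset.card_sdiff_of_subset hT.1, hc, hT.2]; omega⟩ : Idx r k))
      (j := fun S' _ => (S.1 ∪ W) \ S'.1) ?_ ?_ ?_ ?_ ?_
    · intro T hT
      simp
    · intro S' hS'
      simp only [Finset.mem_filter, Finset.mem_univ, true_and] at hS'
      rw [Finset.mem_powersetCard]
      refine ⟨Finset.sdiff_subset, ?_⟩
      rw [Finset.card_sdiff_of_subset hS', hc, S'.2]; omega
    · intro T hT
      rw [Finset.mem_powersetCard] at hT
      simp only
      exact Finset.sdiff_sdiff_eq_self hT.1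
    · intro S' hS'
      simp only [Finset.mem_filter, Finset.mem_univ, true_and] at hS'
      apply Subtype.ext
      exact Finset.sdiff_sdiff_eq_self hS'
    · intro T hT
      rw [Finset.mem_powersetCard] at hT
      exact vv_eq_ev F r k _ _
  rw [Finset.sum_congr rfl h1, Finset.sum_comm]
  refine Finset.sum_congr rfl (fun S' _ => ?_)
  rw [← Finset.sum_smul]
  congr 1
  unfold BM
  rw [Matrix.mul_apply]
  have h2 : ∀ C : Idx r (k + a), Inc F r k (k + a) S C * (Inc F r k (k + a)).transpose C S' =
      if S.1 ⊆ C.1 then (if S'.1 ⊆ C.1 then (1 : F) else 0) else 0 := by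
    intro C
    rw [Matrix.transpose_apply]
    unfold Inc
    split_ifs <;> simp
  rw [Finset.sum_congr rfl (fun C _ => h2 C),
    ← Finset.sum_filter (p := fun C : Idx r (k + a) => S.1 ⊆ C.1)]
  refine Finset.sum_bij' (i := fun W hW => (⟨S.1 ∪ W, by
      rw [Finset.mem_powersetCard] at hW
      rw [Finset.card_union_of_disjoint
        (Finset.disjoint_of_subset_right hW.1 disjoint_compl_right), S.2, hW.2]⟩ : Idx r (k + a)))
      (j := fun C _ => C.1 \ S.1) ?_ ?_ ?_ ?_ ?_
  · intro W hW
    simp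
  · intro C hC
    simp only [Finset.mem_filter, Finset.mem_univ, true_and] at hC
    rw [Finset.mem_powersetCard]
    refine ⟨?_, ?_⟩
    · intro x hx
      simp only [Finset.mem_sdiff] at hx
      simpa using hx.2
    · rw [Finset.card_sdiff_of_subset hC, C.2, S.2]; omega
  · intro W hW
    rw [Finset.mem_powersetCard] at hW
    simp only
    exact Finset.union_sdiff_cancel_left
      (Finset.disjoint_of_subset_right hW.1 disjoint_compl_right)
  · intro C hC
    simp only [Finset.mem_filter, Finset.mem_univ, true_and] at hC
    apply Subtype.ext
    exact Finset.union_sdiff_of_subset hC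
  · intro W hW
    rfl

theorem lucas3 (F : Type*) [Field F] [CharP F 3] (u a c b d : ℕ) (hc : c < 3 ^ u)
    (hd : d < 3 ^ u) :
    ((Nat.choose (a * 3 ^ u + c) (b * 3 ^ u + d) : ℕ) : F)
      = ((Nat.choose a b : ℕ) : F) * ((Nat.choose c d : ℕ) : F) := by
  have : Fact (Nat.Prime 3) := ⟨Nat.prime_three⟩
  have key : ∀ n l : ℕ, ((Nat.choose n l : ℕ) : F) =
      ((Nat.choose (n % 3) (l % 3) : ℕ) : F) * ((Nat.choose (n / 3) (l / 3) : ℕ) : F) := by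
    intro n l
    rw [← Nat.cast_mul]
    exact (CharP.natCast_eq_natCast F 3).mpr Choose.choose_modEq_choose_mod_mul_choose_div_nat
  induction u generalizing c d with
  | zero =>
    have h1 : c = 0 := by simpa using hc
    have h2 : d = 0 := by simpa using hd
    subst h1; subst h2; simp
  | succ u ih =>
    rw [pow_succ] at hc hd
    rw [key (a * 3 ^ (u + 1) + c), key c d]
    have e : ∀ x y : ℕ, (x * 3 ^ (u + 1) + y) / 3 = x * 3 ^ u + y / 3 := by
      intro x y; rw [pow_succ, ← mul_assoc]; omega
    have e' : ∀ x y : ℕ, (x * 3 ^ (u + 1) + y) % 3 = y % 3 := by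
      intro x y; rw [pow_succ, ← mul_assoc]; omega
    rw [e, e, e', e', ih (c / 3) (d / 3) (by omega) (by omega)]
    ring

theorem bOp_mul (F : Type*) [Field F] [CharP F 3] (r k u a c : ℕ) (hr : 2 * k ≤ r)
    (ha : 1 ≤ a) (hc : c < 3 ^ u) (hk : a * 3 ^ u + c ≤ k) :
    bOp F r k c * bOp F r k (a * 3 ^ u) = bOp F r k (a * 3 ^ u + c) := by
  have hq : 3 ^ u ≤ a * 3 ^ u := Nat.le_mul_of_pos_left _ ha
  unfold bOp
  rw [if_pos (by omega), if_pos (by omega), if_pos hk, bRaw_eq, bRaw_eq, bRaw_eq, toE_mul]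
  congr 1
  rw [BM_mul F r k c (a * 3 ^ u) (r - k - c - a * 3 ^ u) (by omega) (by omega)]
  rw [Finset.sum_eq_single 0]
  · have h1 := lucas3 F u a c a 0 hc (by positivity)
    have h2 := lucas3 F u a c 0 c hc hc
    simp only [Nat.add_zero, Nat.zero_mul, Nat.zero_add] at h1 h2
    rw [Nat.sub_zero, Nat.add_comm c, h1, h2]
    simp
  · intro p hp hp0
    rw [Finset.mem_range] at hp
    have h2 := lucas3 F u a (c - p) 0 c (by omega) hc
    have e : c + a * 3 ^ u - p = a * 3 ^ u + (c - p) := by omega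
    simp only [Nat.zero_mul, Nat.zero_add] at h2
    rw [e, h2, Nat.choose_eq_zero_of_lt (show c - p < c by omega)]
    simp
  · simp

theorem psi_range (F : Type*) [Field F] (r k m u : ℕ) :
    psi F r k m u = ∑ j ∈ Finset.range (3 ^ u),
      ((Nat.choose (m % 3 ^ u) (3 ^ u - j) : ℕ) : F) • bOp F r k j := by
  have hpos : 0 < 3 ^ u := by positivity
  unfold psi
  refine Finset.sum_subset ?_ ?_
  · intro j hj
    simp only [Finset.mem_Icc, Finset.mem_range] at hj ⊢
    omega
  · intro j hj hj'
    simp only [Finset.mem_Icc, Finset.mem_range] at hj hj'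
    have : j = 0 := by omega
    subst this
    rw [Nat.choose_eq_zero_of_lt (by rw [Nat.sub_zero]; exact Nat.mod_lt _ hpos)]
    simp

theorem block (F : Type*) [Field F] [CharP F 3] (r k m u a : ℕ) (ha : a ≤ 2)
    (X : Module.End F (YM F r k))
    (hX : ∀ c, 1 ≤ c → c < 3 ^ u → bOp F r k c * X = bOp F r k (a * 3 ^ u + c)) :
    ∑ c ∈ Finset.range (3 ^ u),
      ((Nat.choose (m % 3 ^ (u + 1)) (3 ^ (u + 1) - (a * 3 ^ u + c)) : ℕ) : F) •
        bOp F r k (a * 3 ^ u + c)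
    = ((Nat.choose (digit 3 m u) (3 - a) : ℕ) : F) • bOp F r k (a * 3 ^ u)
      + ((Nat.choose (digit 3 m u) (2 - a) : ℕ) : F) • (psi F r k m u * X) := by
  have hpos : 0 < 3 ^ u := by positivity
  have hm : m % 3 ^ (u + 1) = digit 3 m u * 3 ^ u + m % 3 ^ u := by
    unfold digit
    rw [pow_succ, Nat.mod_mul]; ring
  have hlt : m % 3 ^ u < 3 ^ u := Nat.mod_lt _ hpos
  obtain ⟨e, he⟩ := Nat.exists_eq_add_of_le ha
  have h3 : 3 ^ (u + 1) = a * 3 ^ u + e * 3 ^ u + 3 ^ u := by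
    rw [pow_succ, ← Nat.add_mul, ← he]; ring
  have hs : Finset.range (3 ^ u) = insert 0 (Finset.Icc 1 (3 ^ u - 1)) := by
    ext x; simp only [Finset.mem_range, Finset.mem_insert, Finset.mem_Icc]; omega
  rw [hs, Finset.sum_insert (by simp)]
  congr 1
  · have e1 : 3 ^ (u + 1) - (a * 3 ^ u + 0) = (3 - a) * 3 ^ u + 0 := by
      have : 3 - a = e + 1 := by omega
      rw [this, Nat.add_mul]; omega
    rw [e1, hm, lucas3 F u _ _ _ _ hlt hpos]
    simp
  · unfold psi
    rw [Finset.sum_mul, Finset.smul_sum]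
    refine Finset.sum_congr rfl (fun c hc => ?_)
    rw [Finset.mem_Icc] at hc
    have e1 : 3 ^ (u + 1) - (a * 3 ^ u + c) = (2 - a) * 3 ^ u + (3 ^ u - c) := by
      have : 2 - a = e := by omega
      rw [this]; omega
    rw [e1, hm, lucas3 F u _ _ _ _ hlt (by omega), smul_mul_assoc, hX c hc.1 (by omega), smul_smul]

/-- the recursion
`ψ_{m,t} = ψ_{m,t−1}∘(C(m_{t−1},2)·1 + m_{t−1}·b(3^{t−1}) + b(2·3^{t−1}))
 + C(m_{t−1},2)·b(3^{t−1}) + m_{t−1}·b(2·3^{t−1})` in `S_F(λ)`, `char F = 3`. -/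
theorem stmt16 (F : Type*) [Field F] [CharP F 3] (m : ℕ) (t : ℕ) (ht : 1 ≤ t)
    (r l1 l2 : ℕ) (hm : m + l2 = l1) (hr : l1 + l2 = r) (hl2 : 3 ^ t ≤ l2) :
    psi F r l2 m t =
      psi F r l2 m (t - 1) *
        (((Nat.choose (digit 3 m (t - 1)) 2 : ℕ) : F) • (1 : Module.End F (YM F r l2))
          + ((digit 3 m (t - 1) : ℕ) : F) • bOp F r l2 (3 ^ (t - 1))
          + bOp F r l2 (2 * 3 ^ (t - 1)))
      + ((Nat.choose (digit 3 m (t - 1)) 2 : ℕ) : F) • bOp F r l2 (3 ^ (t - 1))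
      + ((digit 3 m (t - 1) : ℕ) : F) • bOp F r l2 (2 * 3 ^ (t - 1)) := by
  obtain ⟨u, rfl⟩ : ∃ u, t = u + 1 := ⟨t - 1, by omega⟩
  rw [Nat.add_sub_cancel]
  have h3 : 3 ^ (u + 1) = 3 ^ u + 3 ^ u + 3 ^ u := by rw [pow_succ]; ring
  have b0 := block F r l2 m u 0 (by omega) 1 (by intro c _ _; simp)
  have b1 := block F r l2 m u 1 (by omega) (bOp F r l2 (1 * 3 ^ u))
    (fun c _ hc => bOp_mul F r l2 u 1 c (by omega) (by omega) hc (by omega))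
  have b2 := block F r l2 m u 2 (by omega) (bOp F r l2 (2 * 3 ^ u))
    (fun c _ hc => bOp_mul F r l2 u 2 c (by omega) (by omega) hc (by omega))
  have hd : Nat.choose (digit 3 m u) 3 = 0 :=
    Nat.choose_eq_zero_of_lt (Nat.mod_lt _ (by norm_num))
  have hsplit : ∀ f : ℕ → Module.End F (YM F r l2), ∑ j ∈ Finset.range (3 ^ (u + 1)), f j =
      ∑ c ∈ Finset.range (3 ^ u), f (0 * 3 ^ u + c) + ∑ c ∈ Finset.range (3 ^ u), f (1 * 3 ^ u + c)
      + ∑ c ∈ Finset.range (3 ^ u), f (2 * 3 ^ u + c) := by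
    intro f
    rw [h3, Finset.sum_range_add, Finset.sum_range_add]
    simp only [Nat.zero_mul, Nat.zero_add, Nat.one_mul, Nat.two_mul]
  rw [psi_range F r l2 m (u + 1), hsplit, b0, b1, b2]
  simp only [Nat.sub_zero, hd, Nat.cast_zero, zero_smul, Nat.sub_self, Nat.choose_zero_right,
    Nat.cast_one, one_smul, Nat.one_mul, Nat.reduceSub, Nat.choose_one_right, mul_add,
    mul_smul_comm, mul_one]
  abel
end

section
/- Let F be any field, λ = (λ₁, λ₂) a partition of r, and λ+(1²) = (λ₁+1, λ₂+1), a partition of r+2. For a ∈ ℕ₀ let B_λ(a) ∈ End_F(M^λ) be the linear map defined on basis vectors by B_λ(a)(v_S) = Σ_{W ⊆ {1,…,r}∖S, |W| = a} Σ_{T ⊆ S∪W, |T| = a} v_{(S∪W)∖T} (no truncation for large a), and define B_{λ+(1²)}(a) ∈ End_F(M^{λ+(1²)}) by the same formula on {1,…,r+2}. Let j : M^λ → M^{λ+(1²)} be the injective F-linear map given by j(v_S) = v_{{2} ∪ s(S)} − v_{{1} ∪ s(S)}, where s(S) = {i+2 : i ∈ S}. Then for every a ∈ ℕ₀: B_{λ+(1²)}(a)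 ∘ j = j ∘ B_λ(a). -/
open Finset

/-- embedding `i ↦ i+2` -/
def shiftE (r : ℕ) : Fin r ↪ Fin (r + 2) :=
  ⟨fun i => i.succ.succ, fun _ _ h => Fin.succ_injective _ (Fin.succ_injective _ h)⟩

theorem image_eq_map_shift (r : ℕ) (S : Finset (Fin r)) :
    S.image (fun i : Fin r => i.succ.succ) = S.map (shiftE r) := by
  rw [Finset.map_eq_image]; rfl

theorem zero_notMem_shift (r : ℕ) (S : Finset (Fin r)) : (0 : Fin (r+2)) ∉ S.map (shiftE r) := by
  simp only [shiftE, Finset.mem_map, not_exists, not_and]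
  intro x _ hx
  exact Fin.succ_ne_zero x.succ hx

theorem one_notMem_shift (r : ℕ) (S : Finset (Fin r)) : (1 : Fin (r+2)) ∉ S.map (shiftE r) := by
  have h : (1 : Fin (r+2)) = Fin.succ 0 := rfl
  simp only [shiftE, Finset.mem_map, h, not_exists, not_and]
  intro x _ hx
  exact Fin.succ_ne_zero _ (Fin.succ_injective _ hx)

theorem fin_cases_shift (r : ℕ) (x : Fin (r+2)) : x = 0 ∨ x = 1 ∨ ∃ y, x = shiftE r y := by
  refine Fin.cases (Or.inl rfl) (fun y => ?_) x
  refine Fin.cases (Or.inr (Or.inl rfl)) (fun z => ?_) y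
  exact Or.inr (Or.inr ⟨z, rfl⟩)

theorem zero_ne_shift (r : ℕ) (y : Fin r) : (0 : Fin (r+2)) ≠ shiftE r y := by
  intro h; exact zero_notMem_shift r {y} (by simp [← h])

theorem one_ne_shift (r : ℕ) (y : Fin r) : (1 : Fin (r+2)) ≠ shiftE r y := by
  intro h; exact one_notMem_shift r {y} (by simp [← h])

theorem compl_insert_one (r : ℕ) (S : Finset (Fin r)) :
    (insert 1 (S.map (shiftE r)))ᶜ = insert 0 (Sᶜ.map (shiftE r)) := by
  ext x
  rcases fin_cases_shift r x with rfl | rfl | ⟨y, rfl⟩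
  · simp [-Finset.mem_map, zero_notMem_shift]
  · simp [-Finset.mem_map, one_notMem_shift]
  · simp [(zero_ne_shift r y).symm, (one_ne_shift r y).symm]

theorem compl_insert_zero (r : ℕ) (S : Finset (Fin r)) :
    (insert 0 (S.map (shiftE r)))ᶜ = insert 1 (Sᶜ.map (shiftE r)) := by
  ext x
  rcases fin_cases_shift r x with rfl | rfl | ⟨y, rfl⟩
  · simp [-Finset.mem_map, zero_notMem_shift]
  · simp [-Finset.mem_map, one_notMem_shift]
  · simp [(zero_ne_shift r y).symm, (one_ne_shift r y).symm]

theorem sum_pc_insert {α M : Type*} [DecidableEq α] [AddCommMonoid M] (a : ℕ) (x : α)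
    (A : Finset α) (hx : x ∉ A) (g : Finset α → M) :
    ∑ W ∈ powersetCard (a + 1) (insert x A), g W
      = ∑ W ∈ powersetCard (a + 1) A, g W + ∑ W ∈ powersetCard a A, g (insert x W) := by
  rw [powersetCard_succ_insert hx, sum_union, sum_image]
  · intro s hs t ht hst
    have hs' : x ∉ s := fun h => hx ((mem_powersetCard.1 hs).1 h)
    have ht' : x ∉ t := fun h => hx ((mem_powersetCard.1 ht).1 h)
    rw [← erase_insert hs', ← erase_insert ht', hst]
  · rw [disjoint_left]
    intro s hs hs2
    obtain ⟨t, _, rfl⟩ := mem_image.1 hs2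
    exact hx ((mem_powersetCard.1 hs).1 (mem_insert_self _ _))

theorem sum_pc_map {α β M : Type*} [AddCommMonoid M] (a : ℕ) (e : α ↪ β)
    (A : Finset α) (g : Finset β → M) :
    ∑ W ∈ powersetCard a (A.map e), g W = ∑ W ∈ powersetCard a A, g (W.map e) := by
  rw [powersetCard_map, sum_map]; rfl

theorem up_lemma {M : Type*} [AddCommGroup M] (r a : ℕ) (S : Finset (Fin r))
    (f : Finset (Fin (r+2)) → M) :
    ∑ W ∈ powersetCard a (insert 1 (S.map (shiftE r)))ᶜ, f (insert 1 (S.map (shiftE r)) ∪ W)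
    - ∑ W ∈ powersetCard a (insert 0 (S.map (shiftE r)))ᶜ, f (insert 0 (S.map (shiftE r)) ∪ W)
    = ∑ W ∈ powersetCard a Sᶜ,
      (f (insert 1 ((S ∪ W).map (shiftE r))) - f (insert 0 ((S ∪ W).map (shiftE r)))) := by
  rw [compl_insert_one, compl_insert_zero]
  cases a with
  | zero => simp
  | succ a =>
    rw [sum_pc_insert _ _ _ (zero_notMem_shift _ _), sum_pc_insert _ _ _ (one_notMem_shift _ _)]
    simp only [sum_pc_map, sum_sub_distrib, map_union, insert_union, union_insert]
    simp only [Finset.insert_comm (1 : Fin (r+2)) 0]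
    abel

theorem down_lemma {M : Type*} [AddCommGroup M] (r a : ℕ) (U : Finset (Fin r))
    (f : Finset (Fin (r+2)) → M) :
    ∑ T ∈ powersetCard a (insert 1 (U.map (shiftE r))), f (insert 1 (U.map (shiftE r)) \ T)
    - ∑ T ∈ powersetCard a (insert 0 (U.map (shiftE r))), f (insert 0 (U.map (shiftE r)) \ T)
    = ∑ T ∈ powersetCard a U,
      (f (insert 1 ((U \ T).map (shiftE r))) - f (insert 0 ((U \ T).map (shiftE r)))) := by
  have key : ∀ (x : Fin (r+2)), (∀ A : Finset (Fin r), x ∉ A.map (shiftE r)) →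
      (∀ T : Finset (Fin r), insert x (U.map (shiftE r)) \ T.map (shiftE r)
        = insert x ((U \ T).map (shiftE r))) ∧
      (∀ T : Finset (Fin r), insert x (U.map (shiftE r)) \ insert x (T.map (shiftE r))
        = (U \ T).map (shiftE r)) := by
    intro x hx
    refine ⟨fun T => ?_, fun T => ?_⟩
    · rw [insert_sdiff_of_notMem _ (hx T), Finset.map_sdiff]
    · rw [insert_sdiff_insert, sdiff_insert_of_notMem (hx U), Finset.map_sdiff]
  obtain ⟨h0, h0'⟩ := key 0 (zero_notMem_shift r)
  obtain ⟨h1, h1'⟩ := key 1 (one_notMem_shift r)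
  cases a with
  | zero => simp
  | succ a =>
    rw [sum_pc_insert _ _ _ (zero_notMem_shift _ _), sum_pc_insert _ _ _ (one_notMem_shift _ _)]
    simp only [sum_pc_map, sum_sub_distrib, h0, h0', h1, h1']
    abel

theorem vv_eq (F : Type*) [Field F] (r k : ℕ) (S : Finset (Fin r)) (h : S.card = k) :
    vv F r k S = (Finsupp.single ⟨S, h⟩ 1 : Idx r k →₀ F) := dif_pos h

theorem bRaw_vv (F : Type*) [Field F] (r k a : ℕ) (S : Finset (Fin r)) (h : S.card = k) :
    bRaw F r k a (vv F r k S) = ∑ W ∈ powersetCard a Sᶜ,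
      ∑ T ∈ powersetCard a (S ∪ W), vv F r k ((S ∪ W) \ T) := by
  refine (congrArg (bRaw F r k a) (vv_eq F r k S h)).trans ?_
  refine (Finsupp.sum_single_index ?_).trans ?_
  · exact zero_smul _ _
  · exact one_smul _ _

theorem jmap_vv (F : Type*) [Field F] (r k : ℕ) (S : Finset (Fin r)) (h : S.card = k) :
    jmap F r k (vv F r k S) = vv F (r + 2) (k + 1) (insert 1 (S.map (shiftE r)))
      - vv F (r + 2) (k + 1) (insert 0 (S.map (shiftE r))) := by
  rw [← image_eq_map_shift]
  refine (congrArg (jmap F r k) (vv_eq F r k S h)).trans ?_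
  refine (Finsupp.sum_single_index ?_).trans ?_
  · exact zero_smul _ _
  · exact one_smul _ _

/-- the untruncated operators `B_λ(a)` commute with the column-addition map
`j : M^λ → M^{λ+(1²)}`: `B_{λ+(1²)}(a) ∘ j = j ∘ B_λ(a)`. -/
theorem stmt19 (F : Type*) [Field F] (r l1 l2 : ℕ) (hl : l2 ≤ l1) (hr : l1 + l2 = r)
    (a : ℕ) :
    (bRaw F (r + 2) (l2 + 1) a : YM F (r + 2) (l2 + 1) →ₗ[F] YM F (r + 2) (l2 + 1)).comp
        (jmap F r l2)
      = (jmap F r l2).comp (bRaw F r l2 a : YM F r l2 →ₗ[F] YM F r l2) := by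
  have main : ∀ S : Idx r l2, bRaw F (r + 2) (l2 + 1) a (jmap F r l2 (vv F r l2 S.1))
      = jmap F r l2 (bRaw F r l2 a (vv F r l2 S.1)) := by
    rintro ⟨S, hS⟩
    dsimp only
    rw [jmap_vv _ _ _ _ hS, bRaw_vv _ _ _ _ _ hS, map_sub,
      bRaw_vv _ _ _ _ _ (by rw [card_insert_of_notMem (one_notMem_shift _ _), card_map, hS]),
      bRaw_vv _ _ _ _ _ (by rw [card_insert_of_notMem (zero_notMem_shift _ _), card_map, hS])]
    rw [up_lemma r a S (fun U => ∑ T ∈ powersetCard a U, vv F (r+2) (l2+1) (U \ T)), map_sum]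
    refine sum_congr rfl fun W hW => ?_
    rw [down_lemma r a (S ∪ W) (vv F (r+2) (l2+1)), map_sum]
    refine sum_congr rfl fun T hT => ?_
    rw [jmap_vv]
    rw [mem_powersetCard] at hW hT
    have hd : Disjoint S W := by
      rw [disjoint_left]; intro x hx hw
      exact mem_compl.1 (hW.1 hw) hx
    rw [card_sdiff_of_subset hT.1, card_union_of_disjoint hd]
    omega
  refine Finsupp.lhom_ext' fun S => LinearMap.ext_ring ?_
  have h := main S
  rw [show vv F r l2 S.1 = (Finsupp.single S 1 : Idx r l2 →₀ F) from dif_pos S.2] at h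
  exact h
end
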